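/- Let k be a field of characteristic 0, F = k(x₁,…,xₙ), and Z²(𝔸ⁿ) the free abelian group on the height-two primes of k[x₁,…,xₙ]. The total tame symbol Tame induces a group isomorphism from K₂(F)/Const onto the kernel of the divisor map div : ⊕_p κ(p)*/k* → Z²(𝔸ⁿ) (direct sum over all height-one primes p of k[x₁,…,xₙ]). -/

import Mathlib

open scoped TensorProduct

/-- Pre-K₂: the tensor square (over ℤ) of the unit group `F*`, written additively. -/
abbrev K2Pre (F : Type) [Field F] : Type :=
  (Additive Fˣ) ⊗[ℤ] (Additive Fˣ)

/-- The subgroup of Steinberg relations, generated by the elements `f ⊗ (1 - f)`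
for `f ∈ F*`, `f ≠ 1`. -/
noncomputable def steinberg (F : Type) [Field F] : Submodule ℤ (K2Pre F) :=
  Submodule.span ℤ {t | ∃ (f : Fˣ) (h : (1 : F) - (f : F) ≠ 0),
    t = Additive.ofMul f ⊗ₜ[ℤ] Additive.ofMul (Units.mk0 ((1 : F) - (f : F)) h)}

/-- The second Milnor K-group `K₂ᴹ(F)`. -/
noncomputable abbrev MilnorK2 (F : Type) [Field F] : Type :=
  K2Pre F ⧸ steinberg F

/-- The symbol `{f, g} ∈ K₂ᴹ(F)`. -/
noncomputable def MilnorK2.symbol {F : Type} [Field F] (f g : Fˣ) : MilnorK2 F :=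
  Submodule.Quotient.mk (Additive.ofMul f ⊗ₜ[ℤ] Additive.ofMul g)

/-- The subgroup of `K₂ᴹ(F)` generated by the symbols `{f, c}` with `f ∈ F*`, `c ∈ k*`. -/
noncomputable def constSymbols (k F : Type) [Field k] [Field F] [Algebra k F] :
    AddSubgroup (MilnorK2 F) :=
  AddSubgroup.closure {ξ | ∃ (f : Fˣ) (c : kˣ),
    ξ = MilnorK2.symbol f (Units.map (algebraMap k F).toMonoidHom c)}

/-- `K₂(F)/Const`. -/
noncomputable abbrev K2ModConst (k F : Type) [Field k] [Field F] [Algebra k F] : Type :=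
  MilnorK2 F ⧸ constSymbols k F

/-- The class of the symbol `{f, g}` in `K₂(F)/Const`, as a total function on `F`
(junk value `0` if `f` or `g` vanishes). -/
noncomputable def K2ModConst.symb (k : Type) {F : Type} [Field k] [Field F] [Algebra k F]
    (f g : F) : K2ModConst k F :=
  letI := Classical.propDecidable (f ≠ 0 ∧ g ≠ 0)
  if h : f ≠ 0 ∧ g ≠ 0 then
    QuotientAddGroup.mk (MilnorK2.symbol (Units.mk0 f h.1) (Units.mk0 g h.2))
  else 0

/-- The height-one points of `Spec R` (i.e. height-one primes of `R`). -/
def H1 (R : Type) [CommRing R] : Type := {p : PrimeSpectrum R // Order.height p = 1}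

/-- The height-two points of `Spec R` (i.e. height-two primes of `R`). -/
def H2 (R : Type) [CommRing R] : Type := {q : PrimeSpectrum R // Order.height q = 2}

/-- The residue field `κ(p) = Frac(R/p)` of a prime `p`. -/
noncomputable abbrev kappa {R : Type} [CommRing R] (p : PrimeSpectrum R) : Type :=
  FractionRing (R ⧸ p.asIdeal)

/-- The residue class in `κ(p)` of an element of `R`. -/
noncomputable def resid {R : Type} [CommRing R] (p : PrimeSpectrum R) (r : R) : kappa p :=
  algebraMap (R ⧸ p.asIdeal) (kappa p) (Ideal.Quotient.mk p.asIdeal r)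

/-- The `n`-th symbolic power of a prime `p`: the contraction of `(p R_p)^n` from the
localization of `R` at `p`.  For `f` in `R`, the valuation `ν_p(f) ≥ n` iff
`f ∈ symbPow p n`; this is used below to pin down the discrete valuation `ν_p`. -/
noncomputable def symbPow {R : Type} [CommRing R] (p : PrimeSpectrum R) (n : ℕ) : Ideal R :=
  Ideal.comap (algebraMap R (Localization.AtPrime p.asIdeal))
    (Ideal.map (algebraMap R (Localization.AtPrime p.asIdeal)) p.asIdeal ^ n)

/-- `lengthQuot Q hQ c` is the length of the module `A_Q/(c)` over the local ring `A_Q`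
(the localization of `A` at the prime `Q`), expressed as the Krull dimension (= supremum of
lengths of strictly increasing chains) of its lattice of submodules, which for any module
equals its Jordan–Hölder length.  This is the order function `ord_Q(c)` of the local ring
`A_Q`. -/
noncomputable def lengthQuot {A : Type} [CommRing A] (Q : Ideal A) (hQ : Q.IsPrime) (c : A) :
    WithBot ℕ∞ :=
  haveI := hQ
  Order.krullDim (Submodule (Localization.AtPrime Q)
    (Localization.AtPrime Q ⧸ Ideal.span {algebraMap A (Localization.AtPrime Q) c}))

/-- The subgroup of constants `k* ⊆ κ(p)*`. -/
noncomputable def constUnitsSubgroup (k : Type) [Field k] {R : Type} [CommRing R] [Algebra k R]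
    (p : PrimeSpectrum R) : Subgroup (kappa p)ˣ :=
  MonoidHom.range (Units.map (algebraMap k (kappa p)).toMonoidHom)

/-- `κ(p)*/k*` (written additively). -/
noncomputable abbrev kappaUnitsModConst (k : Type) [Field k] {R : Type} [CommRing R]
    [Algebra k R] (p : PrimeSpectrum R) : Type :=
  Additive (kappa p)ˣ ⧸ Subgroup.toAddSubgroup (constUnitsSubgroup k p)

section GerstenComplexes

open Polynomial

section HeightOnePrimes

variable {R : Type} [CommRing R] [IsDomain R] [UniqueFactorizationMonoid R] [IsNoetherianRing R]

/-- The height-one prime generated by a prime element. -/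
def H1.ofPrime {π : R} (hπ : Prime π) : H1 R :=
  ⟨⟨Ideal.span {π}, (Ideal.span_singleton_prime hπ.ne_zero).2 hπ⟩, by
    rw [← PrimeSpectrum.height_eq_orderHeight]
    exact Ideal.height_span_singleton_eq_one_of_mem_nonZeroDivisors
      (mem_nonZeroDivisors_of_ne_zero hπ.ne_zero) hπ.not_isUnit⟩

omit [IsNoetherianRing R] in
theorem H1.exists_prime (p : H1 R) : ∃ π : R, Prime π ∧ p.1.asIdeal = Ideal.span {π} := by
  have hp := p.2
  rw [← PrimeSpectrum.height_eq_orderHeight] at hp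
  obtain ⟨π, hmem, hπ⟩ := p.1.isPrime.exists_mem_prime_of_ne_bot
    (Ideal.ne_bot_of_height_eq_one hp)
  exact ⟨π, hπ, Ideal.eq_span_singleton_of_height_eq_one hp hmem hπ⟩

omit [UniqueFactorizationMonoid R] [IsNoetherianRing R] in
theorem H1.eq_span_of_mem {p : H1 R} {π : R} (hπ : Prime π) (h : π ∈ p.1.asIdeal) :
    p.1.asIdeal = Ideal.span {π} := by
  have hp := p.2
  rw [← PrimeSpectrum.height_eq_orderHeight] at hp
  exact Ideal.eq_span_singleton_of_height_eq_one hp h hπ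

omit [IsDomain R] [UniqueFactorizationMonoid R] [IsNoetherianRing R] in
@[ext]
theorem H1.ext {p p' : H1 R} (h : p.1.asIdeal = p'.1.asIdeal) : p = p' :=
  Subtype.ext (PrimeSpectrum.ext h)

omit [IsDomain R] [UniqueFactorizationMonoid R] [IsNoetherianRing R] in
theorem H1.eq_of_le {p p' : H1 R} (h : p.1.asIdeal ≤ p'.1.asIdeal) : p = p' := by
  have h1 := p.2
  have h2 := p'.2
  rw [← PrimeSpectrum.height_eq_orderHeight] at h1 h2
  have : p'.1.asIdeal.FiniteHeight := by simp [Ideal.finiteHeight_iff, h2]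
  by_contra hne
  have := Ideal.height_strict_mono_of_isPrime_of_isPrime
    (lt_of_le_of_ne h fun e => hne (H1.ext e))
  simp [h1, h2] at this

omit [IsDomain R] [UniqueFactorizationMonoid R] [IsNoetherianRing R] in
theorem H1.notMem_of_isUnit (p : H1 R) {a : R} (ha : IsUnit a) : a ∉ p.1.asIdeal :=
  fun h => p.1.isPrime.ne_top (Ideal.eq_top_of_isUnit_mem _ h ha)

omit [IsDomain R] [UniqueFactorizationMonoid R] [IsNoetherianRing R] in
theorem H2.notMem_of_isUnit (p : H2 R) {a : R} (ha : IsUnit a) : a ∉ p.1.asIdeal :=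
  fun h => p.1.isPrime.ne_top (Ideal.eq_top_of_isUnit_mem _ h ha)

end HeightOnePrimes

/-- The formal structure carried by the Gersten complex of `K₂` of a domain `R`: symbols with
values in a group `K`, tame symbols at the height-one primes with values in groups `G p` receiving
the residue classes of elements of `R` outside `p`, and order functions at the height-two
primes. -/
structure GerstenData (R : Type) [CommRing R] (K : Type) [AddCommGroup K]
    (G : H1 R → Type) [∀ p, AddCommGroup (G p)] where
  /-- the symbol `{a, b}` -/
  sym : R → R → K
  sym_mul_left : ∀ {a b c}, a ≠ 0 → b ≠ 0 → c ≠ 0 → sym (a * b) c = sym a c + sym b c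
  sym_swap : ∀ {a b}, a ≠ 0 → b ≠ 0 → sym a b = -sym b a
  sym_self : ∀ {a}, a ≠ 0 → sym a a = sym a (-1)
  sym_add : ∀ {a b}, a ≠ 0 → b ≠ 0 → a + b ≠ 0 →
    sym a b = sym a (a + b) + sym (a + b) b - sym (a + b) (a + b)
  /-- the tame symbol at `p` -/
  tame : ∀ p, K →+ G p
  /-- the residue class at `p` -/
  res : ∀ p, R → G p
  res_mul : ∀ {p a b}, a ∉ p.1.asIdeal → b ∉ p.1.asIdeal → res p (a * b) = res p a + res p b
  res_eq_iff : ∀ {p a b}, a ∉ p.1.asIdeal → b ∉ p.1.asIdeal →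
    (res p a = res p b ↔ a - b ∈ p.1.asIdeal)
  tame_of_notMem : ∀ {p a b}, a ∉ p.1.asIdeal → b ∉ p.1.asIdeal → tame p (sym a b) = 0
  tame_generator : ∀ {p π b}, p.1.asIdeal = Ideal.span {π} → b ∉ p.1.asIdeal →
    tame p (sym π b) = res p b
  /-- the order function at `q` -/
  ord : ∀ p (_ : H2 R), G p →+ ℤ
  ord_of_not_le : ∀ {p q}, ¬ p.1.asIdeal ≤ q.1.asIdeal → ∀ a, a ∉ p.1.asIdeal →
    ord p q (res p a) = 0
  ord_of_notMem : ∀ {p q a}, a ∉ p.1.asIdeal → a ∉ q.1.asIdeal → ord p q (res p a) = 0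
  ord_pos : ∀ {p q a}, p.1.asIdeal ≤ q.1.asIdeal → a ∉ p.1.asIdeal → a ∈ q.1.asIdeal →
    0 < ord p q (res p a)
  ord_symm : ∀ {p p' q f g}, p ≠ p' → p.1.asIdeal = Ideal.span {f} →
    p'.1.asIdeal = Ideal.span {g} → ord p q (res p g) = ord p' q (res p' f)

namespace GerstenData

section Basic

variable {R : Type} [CommRing R] {K : Type} [AddCommGroup K]
  {G : H1 R → Type} [∀ p, AddCommGroup (G p)] (D : GerstenData R K G)

/-- The subgroup generated by the symbols with entries in a set. -/
def symSpan (s : Set R) : AddSubgroup K :=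
  AddSubgroup.closure {x | ∃ a ∈ s, ∃ b ∈ s, a ≠ 0 ∧ b ≠ 0 ∧ x = D.sym a b}

theorem sym_mem_symSpan {s : Set R} {a b : R} (ha : a ∈ s) (hb : b ∈ s) (ha0 : a ≠ 0)
    (hb0 : b ≠ 0) : D.sym a b ∈ D.symSpan s :=
  AddSubgroup.subset_closure ⟨a, ha, b, hb, ha0, hb0, rfl⟩

theorem symSpan_le {s : Set R} {H : AddSubgroup K}
    (h : ∀ a ∈ s, ∀ b ∈ s, a ≠ 0 → b ≠ 0 → D.sym a b ∈ H) : D.symSpan s ≤ H := by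
  rw [symSpan, AddSubgroup.closure_le]
  rintro _ ⟨a, ha, b, hb, ha0, hb0, rfl⟩
  exact h a ha b hb ha0 hb0

theorem symSpan_mono {s t : Set R} (h : s ⊆ t) : D.symSpan s ≤ D.symSpan t :=
  D.symSpan_le fun _ ha _ hb ha0 hb0 => D.sym_mem_symSpan (h ha) (h hb) ha0 hb0

/-- The subgroup generated by the residue classes at `p`. -/
def unitClasses (p : H1 R) : AddSubgroup (G p) :=
  AddSubgroup.closure {x | ∃ a, a ∉ p.1.asIdeal ∧ x = D.res p a}

theorem res_mem_unitClasses {p : H1 R} {a : R} (ha : a ∉ p.1.asIdeal) :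
    D.res p a ∈ D.unitClasses p :=
  AddSubgroup.subset_closure ⟨a, ha, rfl⟩

theorem mem_unitClasses {p : H1 R} {v : G p} (hv : v ∈ D.unitClasses p) :
    ∃ a s, a ∉ p.1.asIdeal ∧ s ∉ p.1.asIdeal ∧ v = D.res p a - D.res p s := by
  have h1 : (1 : R) ∉ p.1.asIdeal := p.notMem_of_isUnit isUnit_one
  have hmul : ∀ {a b : R}, a ∉ p.1.asIdeal → b ∉ p.1.asIdeal → a * b ∉ p.1.asIdeal :=
    fun ha hb h => (p.1.isPrime.mem_or_mem h).elim ha hb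
  induction hv using AddSubgroup.closure_induction with
  | mem x hx =>
    obtain ⟨a, ha, rfl⟩ := hx
    refine ⟨a * 1, 1, hmul ha h1, h1, ?_⟩
    rw [D.res_mul ha h1, add_sub_cancel_right]
  | zero => exact ⟨1, 1, h1, h1, by simp⟩
  | add x y _ _ hx hy =>
    obtain ⟨a, s, ha, hs, rfl⟩ := hx
    obtain ⟨b, t, hb, ht, rfl⟩ := hy
    refine ⟨a * b, s * t, hmul ha hb, hmul hs ht, ?_⟩
    rw [D.res_mul ha hb, D.res_mul hs ht]
    abel
  | neg x _ hx =>
    obtain ⟨a, s, ha, hs, rfl⟩ := hx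
    exact ⟨s, a, hs, ha, by abel⟩

theorem ord_eq_zero_of_not_le {p : H1 R} {q : H2 R} (h : ¬ p.1.asIdeal ≤ q.1.asIdeal) {v : G p}
    (hv : v ∈ D.unitClasses p) : D.ord p q v = 0 := by
  obtain ⟨a, s, ha, hs, rfl⟩ := D.mem_unitClasses hv
  rw [map_sub, D.ord_of_not_le h a ha, D.ord_of_not_le h s hs, sub_zero]

theorem sym_mul_right {a b c : R} (ha : a ≠ 0) (hb : b ≠ 0) (hc : c ≠ 0) (hbc : b * c ≠ 0) :
    D.sym a (b * c) = D.sym a b + D.sym a c := by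
  rw [D.sym_swap ha hbc, D.sym_mul_left hb hc ha, D.sym_swap hb ha, D.sym_swap hc ha]
  abel

theorem tame_generator_right {p : H1 R} {π b : R} (h : p.1.asIdeal = Ideal.span {π})
    (hπ : π ≠ 0) (hb : b ∉ p.1.asIdeal) : D.tame p (D.sym b π) = -D.res p b := by
  have hb0 : b ≠ 0 := fun h0 => hb (h0 ▸ zero_mem _)
  rw [D.sym_swap hb0 hπ, map_neg, D.tame_generator h hb]

end Basic

section Factorial

variable {R : Type} [CommRing R] [IsDomain R] [UniqueFactorizationMonoid R]
  {K : Type} [AddCommGroup K]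
  {G : H1 R → Type} [∀ p, AddCommGroup (G p)] (D : GerstenData R K G)

theorem sym_mem_of_unit_or_prime {H : AddSubgroup K} {s : Set R}
    (hs : ∀ a ∈ s, a ≠ 0 → ∀ c, c ∣ a → c ∈ s)
    (h : ∀ a ∈ s, ∀ b ∈ s, (IsUnit a ∨ Prime a) → (IsUnit b ∨ Prime b) → D.sym a b ∈ H)
    {a b : R} (ha : a ∈ s) (hb : b ∈ s) (ha0 : a ≠ 0) (hb0 : b ≠ 0) : D.sym a b ∈ H := by
  have ne : ∀ {b : R}, (IsUnit b ∨ Prime b) → b ≠ 0 := fun hb =>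
    hb.elim IsUnit.ne_zero Prime.ne_zero
  have key : ∀ b ∈ s, (IsUnit b ∨ Prime b) → ∀ a, a ≠ 0 → a ∈ s → D.sym a b ∈ H := by
    intro b hb hb' a
    induction a using UniqueFactorizationMonoid.induction_on_prime with
    | h₁ => intro h0; exact absurd rfl h0
    | h₂ x hx => intro _ hxs; exact h x hxs b hb (.inl hx) hb'
    | h₃ a q ha hq ih =>
      intro h0 hqs
      rw [D.sym_mul_left hq.ne_zero ha (ne hb')]
      exact add_mem (h _ (hs _ hqs h0 _ (dvd_mul_right _ _)) b hb (.inr hq) hb')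
        (ih ha (hs _ hqs h0 _ (dvd_mul_left _ _)))
  induction b using UniqueFactorizationMonoid.induction_on_prime with
  | h₁ => exact absurd rfl hb0
  | h₂ x hx => exact key x hb (.inl hx) a ha0 ha
  | h₃ b q hb1 hq ih =>
    rw [D.sym_mul_right ha0 hq.ne_zero hb1 hb0]
    exact add_mem (key q (hs _ hb hb0 _ (dvd_mul_right _ _)) (.inr hq) a ha0 ha)
      (ih (hs _ hb hb0 _ (dvd_mul_left _ _)) hb1)

variable [IsNoetherianRing R]

/-- The elements of `K` whose tame symbols form a finitely supported family of unit classes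
with trivial divisor. -/
def cycleSubgroup : AddSubgroup K where
  carrier := {ξ | {p | D.tame p ξ ≠ 0}.Finite ∧ (∀ p, D.tame p ξ ∈ D.unitClasses p) ∧
    ∀ q, ∑ᶠ p, D.ord p q (D.tame p ξ) = 0}
  zero_mem' := by simp
  add_mem' := by
    rintro x y ⟨h1, h2, h3⟩ ⟨h1', h2', h3'⟩
    refine ⟨(h1.union h1').subset fun p hp => ?_, fun p => ?_, fun q => ?_⟩
    · by_contra hc
      simp only [Set.mem_union, Set.mem_ofPred_eq, not_or, not_not] at hc
      exact hp (by rw [map_add, hc.1, hc.2, add_zero])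
    · rw [map_add]
      exact add_mem (h2 p) (h2' p)
    · simp only [map_add]
      rw [finsum_add_distrib, h3, h3', add_zero]
      · exact h1.subset fun p hp hc => hp (by simp [hc])
      · exact h1'.subset fun p hp hc => hp (by simp [hc])
  neg_mem' := by
    rintro x ⟨h1, h2, h3⟩
    refine ⟨?_, fun p => ?_, fun q => ?_⟩
    · simpa using h1
    · rw [map_neg]
      exact neg_mem (h2 p)
    · simp only [map_neg, finsum_neg_distrib, h3, neg_zero]

omit [UniqueFactorizationMonoid R] in
theorem sym_prime_unit_mem {π u : R} (hπ : Prime π) (hu : IsUnit u) :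
    D.sym π u ∈ D.cycleSubgroup := by
  have h0 : ∀ p, p ≠ H1.ofPrime hπ → D.tame p (D.sym π u) = 0 := by
    intro p hp
    refine D.tame_of_notMem (fun h => hp (H1.ext ?_)) (p.notMem_of_isUnit hu)
    exact H1.eq_span_of_mem hπ h
  have h1 : D.tame (H1.ofPrime hπ) (D.sym π u) = D.res (H1.ofPrime hπ) u :=
    D.tame_generator rfl (H1.notMem_of_isUnit _ hu)
  refine ⟨(Set.finite_singleton (H1.ofPrime hπ)).subset fun p hp => ?_, fun p => ?_, fun q => ?_⟩
  · by_contra hc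
    exact hp (h0 p hc)
  · by_cases hp : p = H1.ofPrime hπ
    · subst hp
      rw [h1]
      exact D.res_mem_unitClasses (H1.notMem_of_isUnit _ hu)
    · rw [h0 p hp]
      exact zero_mem _
  · rw [finsum_eq_single _ (H1.ofPrime hπ) fun p hp => by rw [h0 p hp, map_zero], h1]
    exact D.ord_of_notMem (H1.notMem_of_isUnit _ hu) (H2.notMem_of_isUnit _ hu)

omit [UniqueFactorizationMonoid R] in
theorem sym_prime_prime_mem {π π' : R} (hπ : Prime π) (hπ' : Prime π') :
    D.sym π π' ∈ D.cycleSubgroup := by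
  by_cases hass : Associated π π'
  · obtain ⟨u, rfl⟩ := hass
    have hu : (u : R) ≠ 0 := u.ne_zero
    rw [D.sym_mul_right hπ.ne_zero hπ.ne_zero hu hπ'.ne_zero, D.sym_self hπ.ne_zero]
    exact add_mem (D.sym_prime_unit_mem hπ isUnit_one.neg) (D.sym_prime_unit_mem hπ u.isUnit)
  · set P := H1.ofPrime hπ with hP
    set P' := H1.ofPrime hπ' with hP'
    have hn : π' ∉ P.1.asIdeal := fun h =>
      hass (hπ.associated_of_dvd hπ' (Ideal.mem_span_singleton.1 h))
    have hn' : π ∉ P'.1.asIdeal := fun h =>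
      hass (hπ'.associated_of_dvd hπ (Ideal.mem_span_singleton.1 h)).symm
    have hne : P ≠ P' := fun h => hn (h ▸ Ideal.mem_span_singleton_self π')
    have h0 : ∀ p, p ≠ P → p ≠ P' → D.tame p (D.sym π π') = 0 := by
      intro p hp hp'
      exact D.tame_of_notMem (fun h => hp (H1.ext (H1.eq_span_of_mem hπ h)))
        (fun h => hp' (H1.ext (H1.eq_span_of_mem hπ' h)))
    have h1 : D.tame P (D.sym π π') = D.res P π' := D.tame_generator rfl hn
    have h2 : D.tame P' (D.sym π π') = -D.res P' π :=
      D.tame_generator_right rfl hπ'.ne_zero hn'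
    refine ⟨(Set.toFinite {P, P'}).subset fun p hp => ?_, fun p => ?_, fun q => ?_⟩
    · by_contra hc
      simp only [Set.mem_insert_iff, Set.mem_singleton_iff, not_or] at hc
      exact hp (h0 p hc.1 hc.2)
    · by_cases hp : p = P
      · rw [hp, h1]
        exact D.res_mem_unitClasses hn
      · by_cases hp' : p = P'
        · rw [hp', h2]
          exact neg_mem (D.res_mem_unitClasses hn')
        · rw [h0 p hp hp']
          exact zero_mem _
    · classical
      rw [finsum_eq_sum_of_support_subset (s := {P, P'}), Finset.sum_pair hne, h1, h2, map_neg,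
        D.ord_symm hne rfl rfl, add_neg_cancel]
      intro p hp
      by_contra hc
      simp only [Finset.coe_insert, Finset.coe_singleton, Set.mem_insert_iff,
        Set.mem_singleton_iff, not_or] at hc
      exact hp (by simp [h0 p hc.1 hc.2])

theorem symSpan_univ_le_cycleSubgroup : D.symSpan Set.univ ≤ D.cycleSubgroup := by
  refine D.symSpan_le fun a ha b hb ha0 hb0 => ?_
  refine D.sym_mem_of_unit_or_prime (fun _ _ _ _ _ => Set.mem_univ _) ?_ ha hb ha0 hb0
  rintro a - b - (ha | ha) (hb | hb)
  · have h0 : ∀ p, D.tame p (D.sym a b) = 0 := fun p =>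
      D.tame_of_notMem (p.notMem_of_isUnit ha) (p.notMem_of_isUnit hb)
    exact ⟨by simp [h0], fun p => by rw [h0]; exact zero_mem _, fun q => by simp [h0]⟩
  · rw [D.sym_swap ha.ne_zero hb.ne_zero]
    exact neg_mem (D.sym_prime_unit_mem hb ha)
  · exact D.sym_prime_unit_mem ha hb
  · exact D.sym_prime_prime_mem ha hb

end Factorial

end GerstenData

namespace GerstenData

/-- Restriction of Gersten data along an injective ring homomorphism that extends height-one and
height-two primes to primes of the same height. -/
def comap {R S : Type} [CommRing R] [CommRing S] {K : Type} [AddCommGroup K]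
    {G : H1 S → Type} [∀ p, AddCommGroup (G p)] (D : GerstenData S K G) (φ : R →+* S)
    (hφ : Function.Injective φ) (m₁ : H1 R → H1 S) (m₂ : H2 R → H2 S)
    (h₁ : ∀ p, (m₁ p).1.asIdeal = p.1.asIdeal.map φ)
    (h₁' : ∀ p a, φ a ∈ (m₁ p).1.asIdeal ↔ a ∈ p.1.asIdeal)
    (h₂ : ∀ p, (m₂ p).1.asIdeal = p.1.asIdeal.map φ)
    (h₂' : ∀ p a, φ a ∈ (m₂ p).1.asIdeal ↔ a ∈ p.1.asIdeal) :
    GerstenData R K (fun p => G (m₁ p)) :=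
  have ne : ∀ {a : R}, a ≠ 0 → φ a ≠ 0 := fun h => (map_ne_zero_iff φ hφ).2 h
  have nm : ∀ {p a}, a ∉ p.1.asIdeal → φ a ∉ (m₁ p).1.asIdeal := fun h => mt (h₁' _ _).1 h
  have gen : ∀ {p : H1 R} {f : R}, p.1.asIdeal = Ideal.span {f} →
      (m₁ p).1.asIdeal = Ideal.span {φ f} := fun h => by
    rw [h₁, h, Ideal.map_span, Set.image_singleton]
  { sym := fun a b => D.sym (φ a) (φ b)
    sym_mul_left := fun ha hb hc => by rw [map_mul, D.sym_mul_left (ne ha) (ne hb) (ne hc)]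
    sym_swap := fun ha hb => D.sym_swap (ne ha) (ne hb)
    sym_self := fun ha => by rw [D.sym_self (ne ha), map_neg, map_one]
    sym_add := fun ha hb hab => by
      rw [map_add]
      exact D.sym_add (ne ha) (ne hb) (by rw [← map_add]; exact ne hab)
    tame := fun p => D.tame (m₁ p)
    res := fun p a => D.res (m₁ p) (φ a)
    res_mul := fun ha hb => by rw [map_mul, D.res_mul (nm ha) (nm hb)]
    res_eq_iff := fun ha hb => by rw [D.res_eq_iff (nm ha) (nm hb), ← map_sub, h₁']
    tame_of_notMem := fun ha hb => D.tame_of_notMem (nm ha) (nm hb)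
    tame_generator := fun hp hb => D.tame_generator (gen hp) (nm hb)
    ord := fun p q => D.ord (m₁ p) (m₂ q)
    ord_of_not_le := fun h a ha => D.ord_of_not_le
      (fun hle => h fun x hx => (h₂' _ _).1 (hle ((h₁' _ _).2 hx))) _ (nm ha)
    ord_of_notMem := fun ha hq => D.ord_of_notMem (nm ha) (mt (h₂' _ _).1 hq)
    ord_pos := fun h ha hq => D.ord_pos (by rw [h₁, h₂]; exact Ideal.map_mono h) (nm ha)
      ((h₂' _ _).2 hq)
    ord_symm := fun {p p'} _ _ _ h hf hg => D.ord_symm (fun e => h (by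
      ext x
      rw [← h₁' p, ← h₁' p', e])) (gen hf) (gen hg) }

end GerstenData

section Polynomial

variable {R : Type} [CommRing R]

theorem Ideal.C_mem_map_C_iff {I : Ideal R} {a : R} :
    Polynomial.C a ∈ I.map Polynomial.C ↔ a ∈ I := by
  refine ⟨fun h => ?_, fun h => Ideal.mem_map_of_mem _ h⟩
  simpa using Ideal.mem_map_C_iff.1 h 0

theorem Ideal.height_map_C_of_isPrime [IsNoetherianRing R] (p : Ideal R) [p.IsPrime] :
    (p.map Polynomial.C).height = p.height := by
  have : (p.map Polynomial.C).IsPrime := Ideal.isPrime_map_C_of_isPrime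
  have : (p.map Polynomial.C).LiesOver p := ⟨by
    ext a
    exact Ideal.C_mem_map_C_iff.symm⟩
  simp [Ideal.height_eq_height_add_of_liesOver_of_hasGoingDown p]

/-- The extension of a height-one prime to the polynomial ring. -/
noncomputable def H1.mapC [IsNoetherianRing R] (p : H1 R) : H1 R[X] :=
  ⟨⟨p.1.asIdeal.map Polynomial.C, Ideal.isPrime_map_C_of_isPrime⟩, by
    rw [← PrimeSpectrum.height_eq_orderHeight]
    simp only
    rw [Ideal.height_map_C_of_isPrime, PrimeSpectrum.height_eq_orderHeight, p.2]⟩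

/-- The extension of a height-two prime to the polynomial ring. -/
noncomputable def H2.mapC [IsNoetherianRing R] (p : H2 R) : H2 R[X] :=
  ⟨⟨p.1.asIdeal.map Polynomial.C, Ideal.isPrime_map_C_of_isPrime⟩, by
    rw [← PrimeSpectrum.height_eq_orderHeight]
    simp only
    rw [Ideal.height_map_C_of_isPrime, PrimeSpectrum.height_eq_orderHeight, p.2]⟩

/-- Restriction of Gersten data from `R[X]` to `R`. -/
noncomputable def GerstenData.restrictC [IsNoetherianRing R] {K : Type} [AddCommGroup K]
    {G : H1 R[X] → Type} [∀ p, AddCommGroup (G p)] (D : GerstenData R[X] K G) :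
    GerstenData R K (fun p => G p.mapC) :=
  D.comap Polynomial.C Polynomial.C_injective H1.mapC H2.mapC (fun _ => rfl)
    (fun _ _ => Ideal.C_mem_map_C_iff) (fun _ => rfl) (fun _ _ => Ideal.C_mem_map_C_iff)

theorem Polynomial.exists_C_mul_eq_mul_add [IsDomain R] {π : R[X]} (hπ : 0 < π.natDegree)
    (f : R[X]) : ∃ c : R, c ≠ 0 ∧ ∃ q r : R[X], C c * f = π * q + r ∧
      r.natDegree < π.natDegree ∧ (q ≠ 0 → π.natDegree + q.natDegree ≤ f.natDegree) := by
  have hπ0 : π ≠ 0 := by rintro rfl; simp at hπ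
  suffices H : ∀ n (f : R[X]), f.natDegree ≤ n → ∃ c : R, c ≠ 0 ∧ ∃ q r : R[X],
      C c * f = π * q + r ∧ r.natDegree < π.natDegree by
    obtain ⟨c, hc, q, r, h, hr⟩ := H _ f le_rfl
    refine ⟨c, hc, q, r, h, hr, fun hq => ?_⟩
    have h1 : (π * q).natDegree = π.natDegree + q.natDegree := natDegree_mul hπ0 hq
    have h2 : π * q = C c * f - r := by rw [h]; ring
    have h3 := natDegree_sub_le (C c * f) r
    rw [← h2, h1, natDegree_C_mul hc] at h3
    omega
  intro n
  induction n with
  | zero => exact fun f hf => ⟨1, one_ne_zero, 0, f, by simp, by omega⟩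
  | succ n ih =>
    intro f hf
    by_cases hlt : f.natDegree < π.natDegree
    · exact ⟨1, one_ne_zero, 0, f, by simp, hlt⟩
    have hf0 : f ≠ 0 := by rintro rfl; simp at hlt; omega
    have hlf := leadingCoeff_ne_zero.2 hf0
    have hlπ := leadingCoeff_ne_zero.2 hπ0
    have hX : π * X ^ (f.natDegree - π.natDegree) ≠ 0 := mul_ne_zero hπ0 (by simp)
    have hdeg : (π * X ^ (f.natDegree - π.natDegree)).natDegree = f.natDegree := by
      rw [natDegree_mul hπ0 (by simp), natDegree_X_pow]; omega
    set g := C π.leadingCoeff * f -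
      C f.leadingCoeff * (π * X ^ (f.natDegree - π.natDegree)) with hg
    have hgn : g.natDegree ≤ n := by
      have : g.degree < (C π.leadingCoeff * f).degree := by
        refine degree_sub_lt_left ?_ (mul_ne_zero (by simpa using hπ0) hf0) ?_
        · rw [degree_C_mul hlπ, degree_C_mul hlf, degree_eq_natDegree hf0,
            degree_eq_natDegree hX, hdeg]
        · simp [mul_comm]
      rw [degree_C_mul hlπ, degree_eq_natDegree hf0] at this
      by_cases hg0 : g = 0
      · simp [hg0]
      · rw [degree_eq_natDegree hg0] at this
        have := Nat.cast_lt.1 this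
        omega
    obtain ⟨c, hc, q, r, h, hr⟩ := ih g hgn
    refine ⟨c * π.leadingCoeff, mul_ne_zero hc hlπ,
      q + C c * C f.leadingCoeff * X ^ (f.natDegree - π.natDegree), r, ?_, hr⟩
    rw [hg] at h
    rw [C_mul]
    linear_combination h

variable [IsDomain R] [UniqueFactorizationMonoid R]

/-- A prime element generating a height-one prime of `R[X]`. -/
noncomputable def H1.gen (p : H1 R[X]) : R[X] := p.exists_prime.choose

theorem H1.prime_gen (p : H1 R[X]) : Prime p.gen := p.exists_prime.choose_spec.1

theorem H1.asIdeal_eq (p : H1 R[X]) : p.1.asIdeal = Ideal.span {p.gen} :=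
  p.exists_prime.choose_spec.2

theorem H1.mem_iff (p : H1 R[X]) {f : R[X]} : f ∈ p.1.asIdeal ↔ p.gen ∣ f := by
  rw [p.asIdeal_eq, Ideal.mem_span_singleton]

/-- The degree of a height-one prime of `R[X]` over the fraction field of `R`. -/
noncomputable def H1.deg (p : H1 R[X]) : ℕ := p.gen.natDegree

theorem H1.notMem_of_natDegree_lt (p : H1 R[X]) {f : R[X]} (hf : f ≠ 0)
    (h : f.natDegree < p.deg) : f ∉ p.1.asIdeal := fun hm =>
  absurd (natDegree_le_of_dvd (p.mem_iff.1 hm) hf) (not_le.2 h)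

theorem H1.gen_notMem {p p' : H1 R[X]} (h : p ≠ p') : p.gen ∉ p'.1.asIdeal := fun hm =>
  h (H1.ext (p.asIdeal_eq.trans (H1.eq_span_of_mem p.prime_gen hm).symm))

end Polynomial

namespace GerstenData

section Milnor

variable {R : Type} [CommRing R] [IsDomain R] [UniqueFactorizationMonoid R]
  {K : Type} [AddCommGroup K] {G : H1 R[X] → Type} [∀ p, AddCommGroup (G p)]
  (D : GerstenData R[X] K G)

/-- The subgroup generated by the symbols of polynomials of degree at most `d`. -/
noncomputable def filt (d : ℕ) : AddSubgroup K := D.symSpan {f | f.natDegree ≤ d}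

omit [IsDomain R] [UniqueFactorizationMonoid R] in
theorem sym_mem_filt {d : ℕ} {f g : R[X]} (hf : f ≠ 0) (hg : g ≠ 0) (hfd : f.natDegree ≤ d)
    (hgd : g.natDegree ≤ d) : D.sym f g ∈ D.filt d :=
  D.sym_mem_symSpan (s := {f | f.natDegree ≤ d}) hfd hgd hf hg

theorem tame_eq_zero_of_mem_filt {d : ℕ} {p : H1 R[X]} (hp : d < p.deg) {ξ : K}
    (hξ : ξ ∈ D.filt d) : D.tame p ξ = 0 := by
  have : D.filt d ≤ (D.tame p).ker := D.symSpan_le fun a ha b hb ha0 hb0 =>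
    D.tame_of_notMem (p.notMem_of_natDegree_lt ha0 (lt_of_le_of_lt ha hp))
      (p.notMem_of_natDegree_lt hb0 (lt_of_le_of_lt hb hp))
  exact this hξ

theorem exists_sym_add_sym_sub_mem_filt {d : ℕ} {p : H1 R[X]} (hp : p.deg = d + 1) {g g' : R[X]}
    (hg : g ≠ 0) (hg' : g' ≠ 0) (hgd : g.natDegree ≤ d) (hgd' : g'.natDegree ≤ d) :
    ∃ r : R[X], ∃ c : R, r ≠ 0 ∧ c ≠ 0 ∧ r.natDegree ≤ d ∧
      D.sym p.gen g + D.sym p.gen g' + D.sym p.gen (C c) - D.sym p.gen r ∈ D.filt d := by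
  have hπ := p.prime_gen
  have hπd : p.gen.natDegree = d + 1 := hp
  obtain ⟨c, hc, q, r, h, hr, hq⟩ := exists_C_mul_eq_mul_add (by omega : 0 < p.gen.natDegree)
    (g * g')
  have hC : (C c : R[X]) ≠ 0 := C_ne_zero.2 hc
  have hgg : g * g' ≠ 0 := mul_ne_zero hg hg'
  have he : C c * (g * g') ≠ 0 := mul_ne_zero hC hgg
  have hπe : ¬ p.gen ∣ C c * (g * g') := by
    intro hd
    rw [hπ.dvd_mul, hπ.dvd_mul, ← p.mem_iff, ← p.mem_iff, ← p.mem_iff] at hd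
    rcases hd with hd | hd | hd
    · exact p.notMem_of_natDegree_lt hC (by rw [natDegree_C]; omega) hd
    · exact p.notMem_of_natDegree_lt hg (by omega) hd
    · exact p.notMem_of_natDegree_lt hg' (by omega) hd
  have hr0 : r ≠ 0 := by
    rintro rfl
    exact hπe ⟨q, by rw [h, add_zero]⟩
  refine ⟨r, c, hr0, hc, by omega, ?_⟩
  have hsum : D.sym p.gen (C c * (g * g')) =
      D.sym p.gen (C c) + (D.sym p.gen g + D.sym p.gen g') := by
    rw [D.sym_mul_right hπ.ne_zero hC hgg he, D.sym_mul_right hπ.ne_zero hg hg' hgg]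
  by_cases hq0 : q = 0
  · rw [hq0, mul_zero, zero_add] at h
    rw [← h, hsum]
    convert zero_mem (D.filt d) using 1
    abel
  · have hqd : q.natDegree ≤ d := by
      have := hq hq0
      rw [natDegree_mul hg hg'] at this
      omega
    have hleft : ∀ y : R[X], y ≠ 0 → y.natDegree ≤ d →
        D.sym (C c * (g * g')) y ∈ D.filt d := by
      intro y hy hyd
      rw [D.sym_mul_left hC hgg hy, D.sym_mul_left hg hg' hy]
      exact add_mem (D.sym_mem_filt hC hy (by simp) hyd)
        (add_mem (D.sym_mem_filt hg hy hgd hyd) (D.sym_mem_filt hg' hy hgd' hyd))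
    have hself : D.sym (C c * (g * g')) (C c * (g * g')) ∈ D.filt d := by
      rw [D.sym_mul_right he hC hgg he, D.sym_mul_right he hg hg' hgg]
      exact add_mem (hleft _ hC (by simp)) (add_mem (hleft _ hg hgd) (hleft _ hg' hgd'))
    have hadd := D.sym_add (mul_ne_zero hπ.ne_zero hq0) hr0 (by rwa [← h])
    rw [← h, D.sym_mul_left hπ.ne_zero hq0 hr0, D.sym_mul_left hπ.ne_zero hq0 he, hsum] at hadd
    have h1 : D.sym q (C c * (g * g')) ∈ D.filt d := by
      rw [D.sym_swap hq0 he]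
      exact neg_mem (hleft _ hq0 hqd)
    have h2 := D.sym_mem_filt hq0 hr0 hqd (by omega : r.natDegree ≤ d)
    have h3 := hleft r hr0 (by omega)
    have : D.sym p.gen g + D.sym p.gen g' + D.sym p.gen (C c) - D.sym p.gen r =
        D.sym q r - D.sym q (C c * (g * g')) - D.sym (C c * (g * g')) r +
          D.sym (C c * (g * g')) (C c * (g * g')) := by
      rw [eq_sub_of_add_eq hadd]
      abel
    rw [this]
    exact add_mem (sub_mem (sub_mem h2 h1) h3) hself

/-- The symbols `{π, g / h}` with `g` and `h` of degree less than `deg π`, for `π` a generator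
of `p`, modulo symbols of lower degree. -/
noncomputable def pureAt (d : ℕ) (p : H1 R[X]) (hp : p.deg = d + 1) : AddSubgroup K where
  carrier := {ξ | ∃ g h : R[X], g ≠ 0 ∧ h ≠ 0 ∧ g.natDegree ≤ d ∧ h.natDegree ≤ d ∧
    ξ - (D.sym p.gen g - D.sym p.gen h) ∈ D.filt d}
  zero_mem' := ⟨1, 1, one_ne_zero, one_ne_zero, by simp, by simp, by simp⟩
  add_mem' := by
    rintro x y ⟨g, h, hg, hh, hgd, hhd, hx⟩ ⟨g', h', hg', hh', hgd', hhd', hy⟩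
    obtain ⟨r, c, hr, hc, hrd, h1⟩ := D.exists_sym_add_sym_sub_mem_filt hp hg hg' hgd hgd'
    obtain ⟨r', c', hr', hc', hrd', h2⟩ := D.exists_sym_add_sym_sub_mem_filt hp hh hh' hhd hhd'
    have hC : (C c : R[X]) ≠ 0 := C_ne_zero.2 hc
    have hC' : (C c' : R[X]) ≠ 0 := C_ne_zero.2 hc'
    refine ⟨C c' * r, C c * r', mul_ne_zero hC' hr, mul_ne_zero hC hr', ?_, ?_, ?_⟩
    · rwa [natDegree_C_mul hc']
    · rwa [natDegree_C_mul hc]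
    · rw [D.sym_mul_right p.prime_gen.ne_zero hC' hr (mul_ne_zero hC' hr),
        D.sym_mul_right p.prime_gen.ne_zero hC hr' (mul_ne_zero hC hr')]
      convert sub_mem (add_mem (add_mem hx hy) h1) h2 using 1
      abel
  neg_mem' := by
    rintro x ⟨g, h, hg, hh, hgd, hhd, hx⟩
    refine ⟨h, g, hh, hg, hhd, hgd, ?_⟩
    convert neg_mem hx using 1
    abel

theorem sym_gen_mem_pureAt {d : ℕ} {p : H1 R[X]} (hp : p.deg = d + 1) {g : R[X]} (hg : g ≠ 0)
    (hgd : g.natDegree ≤ d) : D.sym p.gen g ∈ D.pureAt d p hp := by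
  refine ⟨g, 1, hg, one_ne_zero, hgd, by simp, ?_⟩
  have : D.sym p.gen 1 = 0 := by
    have := D.sym_mul_right p.prime_gen.ne_zero one_ne_zero one_ne_zero (by simp)
    rw [mul_one] at this
    exact left_eq_add.1 this
  simp [this]

theorem tame_eq_zero_of_mem_pureAt {d : ℕ} {p p' : H1 R[X]} (hp : p.deg = d + 1)
    (hp' : p'.deg = d + 1) (hne : p ≠ p') {ξ : K} (hξ : ξ ∈ D.pureAt d p hp) :
    D.tame p' ξ = 0 := by
  obtain ⟨g, h, hg, hh, hgd, hhd, hx⟩ := hξ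
  have := D.tame_eq_zero_of_mem_filt (by omega : d < p'.deg) hx
  rw [map_sub, map_sub, D.tame_of_notMem (H1.gen_notMem hne)
    (p'.notMem_of_natDegree_lt hg (by omega)), D.tame_of_notMem (H1.gen_notMem hne)
    (p'.notMem_of_natDegree_lt hh (by omega))] at this
  simpa using this

theorem mem_filt_of_mem_pureAt {d : ℕ} {p : H1 R[X]} (hp : p.deg = d + 1) {ξ : K}
    (hξ : ξ ∈ D.pureAt d p hp) (h0 : D.tame p ξ = 0) : ξ ∈ D.filt d := by
  obtain ⟨g, h, hg, hh, hgd, hhd, hx⟩ := hξ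
  have hgp := p.notMem_of_natDegree_lt hg (by omega)
  have hhp := p.notMem_of_natDegree_lt hh (by omega)
  have := D.tame_eq_zero_of_mem_filt (by omega : d < p.deg) hx
  rw [map_sub, map_sub, h0, D.tame_generator p.asIdeal_eq hgp,
    D.tame_generator p.asIdeal_eq hhp, zero_sub, neg_eq_zero, sub_eq_zero,
    D.res_eq_iff hgp hhp] at this
  have hgh : g = h := by
    by_contra hne
    refine p.notMem_of_natDegree_lt (sub_ne_zero.2 hne) ?_ this
    have := natDegree_sub_le g h
    omega
  simpa [hgh] using hx

/-- Sums of elements of the subgroups `pureAt d p` and `filt d`. -/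
noncomputable def normalForms (d : ℕ) : AddSubgroup K where
  carrier := {ξ | ∃ f : {p : H1 R[X] // p.deg = d + 1} →₀ K,
    (∀ i, f i ∈ D.pureAt d i.1 i.2) ∧ ξ - f.sum (fun _ x => x) ∈ D.filt d}
  zero_mem' := ⟨0, fun i => zero_mem _, by simp⟩
  add_mem' := by
    rintro x y ⟨f, hf, hx⟩ ⟨f', hf', hy⟩
    refine ⟨f + f', fun i => add_mem (hf i) (hf' i), ?_⟩
    rw [Finsupp.sum_add_index' (fun _ => rfl) (fun _ _ _ => rfl)]
    convert add_mem hx hy using 1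
    abel
  neg_mem' := by
    rintro x ⟨f, hf, hx⟩
    refine ⟨-f, fun i => neg_mem (hf i), ?_⟩
    rw [Finsupp.sum_neg_index (fun _ => rfl)]
    convert neg_mem hx using 1
    simp only [Finsupp.sum, Finset.sum_neg_distrib]
    abel

theorem filt_le_normalForms (d : ℕ) : D.filt d ≤ D.normalForms d := fun x hx =>
  ⟨0, fun i => zero_mem _, by simpa using hx⟩

theorem pureAt_le_normalForms {d : ℕ} {p : H1 R[X]} (hp : p.deg = d + 1) :
    D.pureAt d p hp ≤ D.normalForms d := by
  classical
  refine fun x hx => ⟨Finsupp.single ⟨p, hp⟩ x, fun i => ?_, ?_⟩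
  · rw [Finsupp.single_apply]
    split_ifs with h
    · subst h
      exact hx
    · exact zero_mem _
  · rw [Finsupp.sum_single_index rfl]
    simp

variable [IsNoetherianRing R]

theorem exists_eq_gen_mul {f : R[X]} (hf : Prime f) :
    ∃ p : H1 R[X], ∃ u : R[X], IsUnit u ∧ f = p.gen * u ∧ p.deg = f.natDegree := by
  obtain ⟨u, hu⟩ := (H1.ofPrime hf).prime_gen.associated_of_dvd hf
    ((H1.ofPrime hf).mem_iff.1 (Ideal.mem_span_singleton_self f))
  refine ⟨H1.ofPrime hf, u, u.isUnit, hu.symm, ?_⟩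
  have h := congrArg natDegree hu
  rwa [natDegree_mul (H1.prime_gen _).ne_zero u.ne_zero, natDegree_coe_units, add_zero] at h

theorem sym_prime_mem_normalForms {d : ℕ} {f g : R[X]} (hf : Prime f) (hfd : f.natDegree = d + 1)
    (hg : g ≠ 0) (hgd : g.natDegree ≤ d) : D.sym f g ∈ D.normalForms d := by
  obtain ⟨p, u, hu, rfl, hp⟩ := exists_eq_gen_mul hf
  rw [D.sym_mul_left p.prime_gen.ne_zero hu.ne_zero hg]
  exact add_mem (D.pureAt_le_normalForms (hp.trans hfd) (D.sym_gen_mem_pureAt _ hg hgd))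
    (D.filt_le_normalForms d (D.sym_mem_filt hu.ne_zero hg
      (by rw [natDegree_eq_zero_of_isUnit hu]; omega) hgd))

theorem sym_prime_prime_mem_normalForms {d : ℕ} {f g : R[X]} (hf : Prime f) (hg : Prime g)
    (hfd : f.natDegree = d + 1) (hgd : g.natDegree = d + 1) :
    D.sym f g ∈ D.normalForms d := by
  have hlf := leadingCoeff_ne_zero.2 hf.ne_zero
  have hlg := leadingCoeff_ne_zero.2 hg.ne_zero
  have hCf : (C f.leadingCoeff : R[X]) ≠ 0 := C_ne_zero.2 hlf
  have hCg : (C g.leadingCoeff : R[X]) ≠ 0 := C_ne_zero.2 hlg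
  have hneg : (-1 : R[X]) ≠ 0 := neg_ne_zero.2 one_ne_zero
  have hgg : D.sym g g ∈ D.normalForms d := by
    rw [D.sym_self hg.ne_zero]
    exact D.sym_prime_mem_normalForms hg hgd hneg (by simp)
  have hsm : ∀ {a b : R[X]}, a ≠ 0 → b ≠ 0 → a.natDegree ≤ d → b.natDegree ≤ d →
      D.sym a b ∈ D.normalForms d := fun h1 h2 h3 h4 =>
    D.filt_le_normalForms d (D.sym_mem_filt h1 h2 h3 h4)
  have hright : ∀ {a b : R[X]}, Prime b → b.natDegree = d + 1 → a ≠ 0 → a.natDegree ≤ d →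
      D.sym a b ∈ D.normalForms d := fun hb hbd ha had => by
    rw [D.sym_swap ha hb.ne_zero]
    exact neg_mem (D.sym_prime_mem_normalForms hb hbd ha had)
  set a := C g.leadingCoeff * f with ha
  set e := C f.leadingCoeff * g with he
  have ha0 : a ≠ 0 := mul_ne_zero hCg hf.ne_zero
  have he0 : e ≠ 0 := mul_ne_zero hCf hg.ne_zero
  have hexp : D.sym a e = D.sym (C g.leadingCoeff) (C f.leadingCoeff) +
      D.sym (C g.leadingCoeff) g + (D.sym f (C f.leadingCoeff) + D.sym f g) := by
    rw [ha, D.sym_mul_left hCg hf.ne_zero he0, he,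
      D.sym_mul_right hCg hCf hg.ne_zero he0, D.sym_mul_right hf.ne_zero hCf hg.ne_zero he0]
  suffices hae : D.sym a e ∈ D.normalForms d by
    have h1 := hsm hCg hCf (by simp) (by simp)
    have h2 := hright hg hgd hCg (by simp)
    have h3 := D.sym_prime_mem_normalForms hf hfd hCf (by simp)
    convert sub_mem (sub_mem hae (add_mem h1 h2)) h3 using 1
    rw [hexp]
    abel
  have hee : D.sym e e ∈ D.normalForms d := by
    rw [D.sym_self he0, he, D.sym_mul_left hCf hg.ne_zero hneg]
    exact add_mem (hsm hCf hneg (by simp) (by simp))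
      (D.sym_prime_mem_normalForms hg hgd hneg (by simp))
  by_cases hb : e - a = 0
  · rw [← sub_eq_zero.1 hb]
    exact hee
  have hbd : (e - a).natDegree ≤ d := by
    have hlt : (e - a).degree < e.degree := by
      refine degree_sub_lt_left ?_ he0 ?_
      · rw [he, ha, degree_C_mul hlf, degree_C_mul hlg, degree_eq_natDegree hf.ne_zero,
          degree_eq_natDegree hg.ne_zero, hfd, hgd]
      · simp [he, ha, mul_comm]
    have := natDegree_lt_natDegree hb hlt
    rw [he, natDegree_C_mul hlf, ← he, hgd] at this
    omega
  have hadd := D.sym_add ha0 hb (by rwa [add_sub_cancel])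
  rw [add_sub_cancel] at hadd
  have h1 : D.sym a (e - a) ∈ D.normalForms d := by
    rw [ha, D.sym_mul_left hCg hf.ne_zero hb]
    exact add_mem (hsm hCg hb (by simp) hbd) (D.sym_prime_mem_normalForms hf hfd hb hbd)
  have h2 : D.sym e (e - a) ∈ D.normalForms d := by
    rw [he, D.sym_mul_left hCf hg.ne_zero hb]
    exact add_mem (hsm hCf hb (by simp) hbd) (D.sym_prime_mem_normalForms hg hgd hb hbd)
  convert add_mem (sub_mem h1 h2) hee using 1
  rw [hadd]
  abel

theorem filt_succ_le_normalForms (d : ℕ) : D.filt (d + 1) ≤ D.normalForms d := by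
  refine D.symSpan_le fun a ha b hb ha0 hb0 => ?_
  refine D.sym_mem_of_unit_or_prime (s := {f | f.natDegree ≤ d + 1})
    (fun x hx hx0 c hc => (natDegree_le_of_dvd hc hx0).trans hx) ?_ ha hb ha0 hb0
  have key : ∀ {x : R[X]}, (IsUnit x ∨ Prime x) → ¬ x.natDegree ≤ d → Prime x := by
    rintro x (hx | hx) h
    · rw [natDegree_eq_zero_of_isUnit hx] at h
      omega
    · exact hx
  have ne : ∀ {b : R[X]}, (IsUnit b ∨ Prime b) → b ≠ 0 := fun hb =>
    hb.elim IsUnit.ne_zero Prime.ne_zero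
  intro a ha b hb ha' hb'
  simp only [Set.mem_ofPred_eq] at ha hb
  by_cases had : a.natDegree ≤ d <;> by_cases hbd : b.natDegree ≤ d
  · exact D.filt_le_normalForms d (D.sym_mem_filt (ne ha') (ne hb') had hbd)
  · rw [D.sym_swap (ne ha') (ne hb')]
    exact neg_mem (D.sym_prime_mem_normalForms (key hb' hbd) (by omega) (ne ha') had)
  · exact D.sym_prime_mem_normalForms (key ha' had) (by omega) (ne hb') hbd
  · exact D.sym_prime_prime_mem_normalForms (key ha' had) (key hb' hbd) (by omega) (by omega)

theorem mem_filt_of_mem_filt_succ {d : ℕ} {ξ : K} (hξ : ξ ∈ D.filt (d + 1))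
    (h0 : ∀ p : H1 R[X], p.deg = d + 1 → D.tame p ξ = 0) : ξ ∈ D.filt d := by
  obtain ⟨f, hf, hx⟩ := D.filt_succ_le_normalForms d hξ
  have hfi : ∀ i, f i ∈ D.filt d := by
    intro i
    refine D.mem_filt_of_mem_pureAt i.2 (hf i) ?_
    have := D.tame_eq_zero_of_mem_filt (by rw [i.2]; omega : d < i.1.deg) hx
    rw [map_sub, h0 i.1 i.2, zero_sub, neg_eq_zero, map_finsuppSum, Finsupp.sum,
      Finset.sum_eq_single i] at this
    · exact this
    · intro j _ hj
      exact D.tame_eq_zero_of_mem_pureAt j.2 i.2 (fun h => hj (Subtype.ext h)) (hf j)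
    · intro hi
      rw [Finsupp.notMem_support_iff.1 hi, map_zero]
  convert add_mem hx (sum_mem fun i (_ : i ∈ f.support) => hfi i) using 1
  simp [Finsupp.sum]

omit [IsDomain R] [UniqueFactorizationMonoid R] [IsNoetherianRing R] in
theorem exists_mem_filt {ξ : K} (hξ : ξ ∈ D.symSpan Set.univ) : ∃ d, ξ ∈ D.filt d := by
  have mono : ∀ {d e}, d ≤ e → D.filt d ≤ D.filt e := fun h =>
    D.symSpan_mono fun f hf => le_trans hf h
  induction hξ using AddSubgroup.closure_induction with
  | mem x hx =>
    obtain ⟨a, -, b, -, ha, hb, rfl⟩ := hx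
    exact ⟨max a.natDegree b.natDegree,
      D.sym_mem_symSpan (s := {f | f.natDegree ≤ max a.natDegree b.natDegree})
        (show a.natDegree ≤ _ from le_max_left _ _) (show b.natDegree ≤ _ from le_max_right _ _)
        ha hb⟩
  | zero => exact ⟨0, zero_mem _⟩
  | add x y _ _ hx hy =>
    obtain ⟨d, hd⟩ := hx
    obtain ⟨e, he⟩ := hy
    exact ⟨max d e, add_mem (mono (le_max_left _ _) hd) (mono (le_max_right _ _) he)⟩
  | neg x _ hx =>
    obtain ⟨d, hd⟩ := hx
    exact ⟨d, neg_mem hd⟩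

/-- **Theorem of Milnor**: an element with trivial tame symbols at the primes of positive degree
comes from constant polynomials. -/
theorem mem_filt_zero {ξ : K} (hξ : ξ ∈ D.symSpan Set.univ)
    (h0 : ∀ p : H1 R[X], 0 < p.deg → D.tame p ξ = 0) : ξ ∈ D.filt 0 := by
  obtain ⟨d, hd⟩ := D.exists_mem_filt hξ
  induction d with
  | zero => exact hd
  | succ d ih => exact ih (D.mem_filt_of_mem_filt_succ hd fun p hp => h0 p (by omega))

omit [IsDomain R] [UniqueFactorizationMonoid R] in
theorem filt_zero_eq : D.filt 0 = D.restrictC.symSpan Set.univ := by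
  apply le_antisymm
  · refine D.symSpan_le fun a ha b hb ha0 hb0 => ?_
    rw [eq_C_of_natDegree_le_zero ha] at ha0 ⊢
    rw [eq_C_of_natDegree_le_zero hb] at hb0 ⊢
    exact D.restrictC.sym_mem_symSpan (Set.mem_univ _) (Set.mem_univ _)
      (fun h => ha0 (by rw [h, C_0])) (fun h => hb0 (by rw [h, C_0]))
  · exact D.restrictC.symSpan_le fun a _ b _ ha hb =>
      D.sym_mem_filt (C_ne_zero.2 ha) (C_ne_zero.2 hb) (by simp) (by simp)

/-- Every unit class at a prime of positive degree is a tame symbol of an element all of whose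
other tame symbols are at primes of degree zero. -/
theorem exists_tame_eq_single (p : H1 R[X]) (hp : 0 < p.deg) (v : G p)
    (hv : v ∈ D.unitClasses p) : ∃ ξ ∈ D.symSpan Set.univ, D.tame p ξ = v ∧
      ∀ p' : H1 R[X], 0 < p'.deg → p' ≠ p → D.tame p' ξ = 0 := by
  induction hn : p.deg using Nat.strong_induction_on generalizing p with
  | _ n ih =>
  have hred : ∀ a, a ∉ p.1.asIdeal → ∃ r : R[X], ∃ c : R, r ≠ 0 ∧ c ≠ 0 ∧
      r.natDegree < p.deg ∧ D.res p a = D.res p r - D.res p (C c) := by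
    intro a ha
    obtain ⟨c, hc, q, r, h, hr, -⟩ := exists_C_mul_eq_mul_add hp a
    have hCp : C c ∉ p.1.asIdeal :=
      p.notMem_of_natDegree_lt (C_ne_zero.2 hc) (by rwa [natDegree_C])
    have hrp : r ∉ p.1.asIdeal := by
      rw [p.mem_iff, ← dvd_add_right (dvd_mul_right p.gen q), ← h, ← p.mem_iff]
      exact fun hm => (p.1.isPrime.mem_or_mem hm).elim hCp ha
    refine ⟨r, c, fun h0 => hrp (h0 ▸ zero_mem _), hc, hr, ?_⟩
    rw [eq_sub_iff_add_eq', ← D.res_mul hCp ha, D.res_eq_iff _ hrp, h, add_sub_cancel_right,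
      p.mem_iff]
    · exact dvd_mul_right _ _
    · exact fun hm => (p.1.isPrime.mem_or_mem hm).elim hCp ha
  obtain ⟨a, s, ha, hs, rfl⟩ := D.mem_unitClasses hv
  obtain ⟨r, c, hr, hc, hrd, hra⟩ := hred a ha
  obtain ⟨r', c', hr', hc', hrd', hra'⟩ := hred s hs
  have hC : (C c : R[X]) ≠ 0 := C_ne_zero.2 hc
  have hC' : (C c' : R[X]) ≠ 0 := C_ne_zero.2 hc'
  have hCd : (C c : R[X]).natDegree < p.deg := by rwa [natDegree_C]
  have hCd' : (C c' : R[X]).natDegree < p.deg := by rwa [natDegree_C]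
  set ξ := D.sym p.gen r - D.sym p.gen (C c) - (D.sym p.gen r' - D.sym p.gen (C c')) with hξ
  have hπ := p.prime_gen.ne_zero
  have hmem : ∀ g, g ≠ 0 → D.sym p.gen g ∈ D.symSpan Set.univ := fun g hg =>
    D.sym_mem_symSpan (Set.mem_univ _) (Set.mem_univ _) hπ hg
  have hξm : ξ ∈ D.symSpan Set.univ :=
    sub_mem (sub_mem (hmem _ hr) (hmem _ hC)) (sub_mem (hmem _ hr') (hmem _ hC'))
  have hξp : D.tame p ξ = D.res p a - D.res p s := by
    rw [hξ, map_sub, map_sub, map_sub, hra, hra',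
      D.tame_generator p.asIdeal_eq (p.notMem_of_natDegree_lt hr hrd),
      D.tame_generator p.asIdeal_eq (p.notMem_of_natDegree_lt hr' hrd'),
      D.tame_generator p.asIdeal_eq (p.notMem_of_natDegree_lt hC hCd),
      D.tame_generator p.asIdeal_eq (p.notMem_of_natDegree_lt hC' hCd')]
  have hlow : ∀ p' : H1 R[X], p' ≠ p → p.deg ≤ p'.deg → D.tame p' ξ = 0 := by
    intro p' hne hle
    have h := fun (g : R[X]) (hg : g ≠ 0) (hgd : g.natDegree < p.deg) =>
      D.tame_of_notMem (H1.gen_notMem hne.symm)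
        (p'.notMem_of_natDegree_lt hg (lt_of_lt_of_le hgd hle))
    rw [hξ, map_sub, map_sub, map_sub, h _ hr hrd, h _ hr' hrd', h _ hC hCd, h _ hC' hCd']
    simp
  obtain ⟨hfin, hunit, -⟩ := D.symSpan_univ_le_cycleSubgroup hξm
  have hx : ∀ p' : H1 R[X], ∃ η ∈ D.symSpan Set.univ, 0 < p'.deg → p' ≠ p →
      (D.tame p' η = D.tame p' ξ ∧ ∀ p'' : H1 R[X], 0 < p''.deg → p'' ≠ p' →
        D.tame p'' η = 0) := by
    intro p'
    by_cases h : 0 < p'.deg ∧ p' ≠ p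
    · by_cases hlt : p'.deg < p.deg
      · obtain ⟨η, hη, h1, h2⟩ := ih p'.deg (by omega) p' h.1 (D.tame p' ξ) (hunit p') rfl
        exact ⟨η, hη, fun _ _ => ⟨h1, h2⟩⟩
      · exact ⟨0, zero_mem _, fun _ _ => ⟨by rw [hlow p' h.2 (by omega), map_zero],
          fun _ _ _ => map_zero _⟩⟩
    · exact ⟨0, zero_mem _, fun h1 h2 => absurd ⟨h1, h2⟩ h⟩
  choose η hη hη' using hx
  classical
  set t := (hfin.toFinset.filter fun p' => 0 < p'.deg ∧ p' ≠ p) with ht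
  refine ⟨ξ - ∑ p' ∈ t, η p', sub_mem hξm (sum_mem fun p' _ => hη p'), ?_, ?_⟩
  · rw [map_sub, map_sum, hξp, sub_eq_self]
    refine Finset.sum_eq_zero fun p' hp' => ?_
    obtain ⟨-, h1, h2⟩ := Finset.mem_filter.1 hp'
    exact (hη' p' h1 h2).2 p hp h2.symm
  · intro p' h1 h2
    rw [map_sub, map_sum, sub_eq_zero]
    by_cases hp' : p' ∈ t
    · rw [Finset.sum_eq_single p', (hη' p' h1 h2).1]
      · intro p'' hp'' hne
        obtain ⟨-, h3, h4⟩ := Finset.mem_filter.1 hp''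
        exact (hη' p'' h3 h4).2 p' h1 hne.symm
      · exact fun h => absurd hp' h
    · rw [Finset.sum_eq_zero]
      · by_contra h
        exact hp' (Finset.mem_filter.2 ⟨hfin.mem_toFinset.2 h, h1, h2⟩)
      · intro p'' hp''
        obtain ⟨-, h3, h4⟩ := Finset.mem_filter.1 hp''
        exact (hη' p'' h3 h4).2 p' h1 fun h => hp' (h ▸ hp'')

end Milnor

end GerstenData

section ResidueField

variable {R κ : Type} [CommRing R] [Field κ] {ψ : R →+* κ}

theorem Polynomial.exists_map_eq_C_mul (hψ : ∀ z, ∃ a s, ψ s ≠ 0 ∧ ψ s * z = ψ a) (z : κ[X]) :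
    ∃ s : R, ψ s ≠ 0 ∧ ∃ Z : R[X], Z.map ψ = C (ψ s) * z := by
  induction z using Polynomial.induction_on' with
  | add x y hx hy =>
    obtain ⟨s, hs, X, hX⟩ := hx
    obtain ⟨t, ht, Y, hY⟩ := hy
    refine ⟨s * t, by simp [hs, ht], C t * X + C s * Y, ?_⟩
    simp only [Polynomial.map_add, Polynomial.map_mul, map_C, hX, hY, map_mul]
    ring
  | monomial n z =>
    obtain ⟨a, s, hs, h⟩ := hψ z
    exact ⟨s, hs, monomial n a, by rw [map_monomial, C_mul_monomial, h]⟩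

theorem Polynomial.map_eq_zero_iff_mem_map_C {p : H1 R}
    (hker : ∀ a, ψ a = 0 ↔ a ∈ p.1.asIdeal) {f : R[X]} :
    f.map ψ = 0 ↔ f ∈ p.1.asIdeal.map C := by
  simp [Ideal.mem_map_C_iff, Polynomial.ext_iff, hker]

variable [IsDomain R] [UniqueFactorizationMonoid R] [IsNoetherianRing R]

theorem Polynomial.height_comap_span_irreducible {p : H1 R}
    (hker : ∀ a, ψ a = 0 ↔ a ∈ p.1.asIdeal) (hψ : ∀ z, ∃ a s, ψ s ≠ 0 ∧ ψ s * z = ψ a)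
    {π : κ[X]} (hπ : Irreducible π) :
    ((Ideal.span {π}).comap (mapRingHom ψ)).height = 2 := by
  have hπ' := hπ.prime
  have hP : (Ideal.span {π}).IsPrime := (Ideal.span_singleton_prime hπ'.ne_zero).2 hπ'
  set q := (Ideal.span {π}).comap (mapRingHom ψ) with hq
  have hmem : ∀ f, f ∈ q ↔ π ∣ f.map ψ := fun f => by
    rw [hq, Ideal.mem_comap, Ideal.mem_span_singleton, coe_mapRingHom]
  have hCs : ∀ s, ψ s ≠ 0 → C s ∉ q := fun s hs h => hπ'.not_isUnit <| isUnit_of_dvd_unit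
    ((hmem _).1 h) (by rw [map_C]; exact isUnit_C.2 (isUnit_iff_ne_zero.2 hs))
  have hqP : q.IsPrime := Ideal.comap_isPrime _ _
  obtain ⟨s, hs, P, hPπ⟩ := exists_map_eq_C_mul hψ π
  obtain ⟨p₀, hp₀, hpp⟩ := p.exists_prime
  have hCq : p.1.asIdeal.map C ≤ q := fun f hf => by
    rw [hmem, (map_eq_zero_iff_mem_map_C hker).2 hf]
    exact dvd_zero _
  have hPq : P ∈ q := by
    rw [hmem, hPπ]
    exact dvd_mul_left _ _
  apply le_antisymm
  · classical
    have hmin : q ∈ (Ideal.span (({C p₀, P} : Finset R[X]) : Set R[X])).minimalPrimes := by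
      refine ⟨⟨hqP, ?_⟩, fun J hJ hJq x hx => ?_⟩
      · rw [Ideal.span_le]
        simp only [Finset.coe_insert, Finset.coe_singleton, Set.insert_subset_iff,
          Set.singleton_subset_iff]
        exact ⟨hCq (Ideal.mem_map_of_mem _ (hpp ▸ Ideal.mem_span_singleton_self p₀)), hPq⟩
      · have hJP := hJ.1
        obtain ⟨y, hy⟩ := (hmem x).1 hx
        obtain ⟨t, ht, Y, hY⟩ := exists_map_eq_C_mul hψ y
        have hC₀ : p.1.asIdeal.map C ≤ J := by
          rw [hpp, Ideal.map_span, Set.image_singleton, Ideal.span_singleton_le_iff_mem]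
          exact hJ.2 (Ideal.subset_span (by simp))
        have hPJ : P ∈ J := hJ.2 (Ideal.subset_span (by simp))
        have h1 : C s * (C t * x) - P * Y ∈ J := by
          refine hC₀ ((map_eq_zero_iff_mem_map_C hker).1 ?_)
          rw [Polynomial.map_sub, Polynomial.map_mul, Polynomial.map_mul, Polynomial.map_mul,
            hPπ, hY, hy, map_C, map_C]
          ring
        have h2 : C s * (C t * x) ∈ J := by
          simpa using add_mem h1 (J.mul_mem_right Y hPJ)
        have h3 := (hJP.mem_or_mem h2).resolve_left fun h => hCs s hs (hJq h)
        exact (hJP.mem_or_mem h3).resolve_left fun h => hCs t ht (hJq h)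
    exact (Ideal.height_le_card_of_mem_minimalPrimes_span_finset hmin).trans
      (by exact_mod_cast Finset.card_le_two)
  · have hp := p.2
    rw [← PrimeSpectrum.height_eq_orderHeight] at hp
    have hCp : (p.1.asIdeal.map C).IsPrime := Ideal.isPrime_map_C_of_isPrime
    have hlt : p.1.asIdeal.map C < q := by
      refine lt_of_le_of_ne hCq fun h => ?_
      have : P.map ψ = 0 := (map_eq_zero_iff_mem_map_C hker).2 (h ▸ hPq)
      rw [hPπ, mul_eq_zero, C_eq_zero] at this
      exact this.elim hs hπ'.ne_zero
    have := Ideal.height_add_one_le_of_lt_of_isPrime hlt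
    rwa [Ideal.height_map_C_of_isPrime, hp, one_add_one_eq_two] at this

/-- The height-two prime of `R[X]` over a height-one prime of `R` given by a closed point of the
generic fibre. -/
noncomputable def H2.ofIrreducible {p : H1 R} (hker : ∀ a, ψ a = 0 ↔ a ∈ p.1.asIdeal)
    (hψ : ∀ z, ∃ a s, ψ s ≠ 0 ∧ ψ s * z = ψ a)
    {π : κ[X]} (hπ : Irreducible π) : H2 R[X] :=
  have : (Ideal.span {π}).IsPrime := (Ideal.span_singleton_prime hπ.ne_zero).2 hπ.prime
  ⟨⟨(Ideal.span {π}).comap (mapRingHom ψ), Ideal.comap_isPrime _ _⟩, by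
    rw [← PrimeSpectrum.height_eq_orderHeight]
    exact Polynomial.height_comap_span_irreducible hker hψ hπ⟩

theorem H2.mem_ofIrreducible {p : H1 R} (hker : ∀ a, ψ a = 0 ↔ a ∈ p.1.asIdeal)
    (hψ : ∀ z, ∃ a s, ψ s ≠ 0 ∧ ψ s * z = ψ a)
    {π : κ[X]} (hπ : Irreducible π) {f : R[X]} :
    f ∈ (H2.ofIrreducible hker hψ hπ).1.asIdeal ↔ π ∣ f.map ψ := by
  simp [H2.ofIrreducible, Ideal.mem_comap, Ideal.mem_span_singleton]

theorem H2.C_mem_ofIrreducible {p : H1 R} (hker : ∀ a, ψ a = 0 ↔ a ∈ p.1.asIdeal)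
    (hψ : ∀ z, ∃ a s, ψ s ≠ 0 ∧ ψ s * z = ψ a)
    {π : κ[X]} (hπ : Irreducible π) {a : R} :
    C a ∈ (H2.ofIrreducible hker hψ hπ).1.asIdeal ↔ a ∈ p.1.asIdeal := by
  rw [H2.mem_ofIrreducible, map_C, ← hker]
  refine ⟨fun h => ?_, fun h => by simp [h]⟩
  by_contra h0
  exact hπ.not_isUnit (isUnit_of_dvd_unit h (isUnit_C.2 (isUnit_iff_ne_zero.2 h0)))

theorem GerstenData.res_sub_res_mem_unitClasses {p : H1 R} (hker : ∀ a, ψ a = 0 ↔ a ∈ p.1.asIdeal)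
    (hψ : ∀ z, ∃ a s, ψ s ≠ 0 ∧ ψ s * z = ψ a)
    {K : Type} [AddCommGroup K]
    {G : H1 R[X] → Type} [∀ p, AddCommGroup (G p)] (D : GerstenData R[X] K G)
    {f g : R[X]} (hf : f ∉ p.mapC.1.asIdeal) (hg : g ∉ p.mapC.1.asIdeal)
    (hord : ∀ q : H2 R[X], (∀ a, C a ∈ q.1.asIdeal ↔ a ∈ p.1.asIdeal) →
      D.ord p.mapC q (D.res p.mapC f) = D.ord p.mapC q (D.res p.mapC g)) :
    D.res p.mapC f - D.res p.mapC g ∈ D.restrictC.unitClasses p := by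
  have hmap : ∀ {f : R[X]}, f ∉ p.mapC.1.asIdeal ↔ f.map ψ ≠ 0 := fun {f} =>
    not_congr (map_eq_zero_iff_mem_map_C hker).symm
  have hmul : ∀ {f g : R[X]}, f ∉ p.mapC.1.asIdeal → g ∉ p.mapC.1.asIdeal →
      f * g ∉ p.mapC.1.asIdeal := fun hf hg h => (p.mapC.1.isPrime.mem_or_mem h).elim hf hg
  have hC : ∀ {a : R}, ψ a ≠ 0 → C a ∉ p.mapC.1.asIdeal := fun ha => hmap.2 (by simpa using ha)
  have hres : ∀ {f g : R[X]}, f ∉ p.mapC.1.asIdeal → g ∉ p.mapC.1.asIdeal →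
      f.map ψ = g.map ψ → D.res p.mapC f = D.res p.mapC g := fun hf hg h =>
    (D.res_eq_iff hf hg).2
      ((map_eq_zero_iff_mem_map_C hker).1 (by rw [Polynomial.map_sub, h, sub_self]))
  have hcl : ∀ {a : R}, ψ a ≠ 0 → D.res p.mapC (C a) ∈ D.restrictC.unitClasses p := fun ha =>
    D.restrictC.res_mem_unitClasses (mt (hker _).2 ha)
  have hle : ∀ q : H2 R[X], (∀ a, C a ∈ q.1.asIdeal ↔ a ∈ p.1.asIdeal) →
      p.mapC.1.asIdeal ≤ q.1.asIdeal := fun q hq =>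
    Ideal.map_le_iff_le_comap.2 fun a ha => (hq a).2 ha
  have hpos : ∀ {f g : R[X]}, f ∉ p.mapC.1.asIdeal → g ∉ p.mapC.1.asIdeal →
      (∀ q : H2 R[X], (∀ a, C a ∈ q.1.asIdeal ↔ a ∈ p.1.asIdeal) →
        D.ord p.mapC q (D.res p.mapC f) = D.ord p.mapC q (D.res p.mapC g)) →
      ∀ π, Irreducible π → π ∣ f.map ψ → π ∣ g.map ψ := by
    intro f g hf hg hord π hπ hd
    rw [← H2.mem_ofIrreducible hker hψ hπ] at hd ⊢
    have hq := fun a => H2.C_mem_ofIrreducible hker hψ hπ (a := a)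
    by_contra hn
    have := D.ord_pos (hle _ hq) hf hd
    rw [hord _ hq, D.ord_of_notMem hg hn] at this
    exact lt_irrefl _ this
  have hdeg : ∀ {f : R[X]}, f ∉ p.mapC.1.asIdeal → (∀ π, Irreducible π → ¬ π ∣ f.map ψ) →
      D.res p.mapC f ∈ D.restrictC.unitClasses p := by
    intro f hf hirr
    have hu : IsUnit (f.map ψ) := by
      by_contra hu
      obtain ⟨π, hπ, hd⟩ := WfDvdMonoid.exists_irreducible_factor hu (hmap.1 hf)
      exact hirr π hπ hd
    obtain ⟨z, hz, hzf⟩ := Polynomial.isUnit_iff.1 hu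
    obtain ⟨a, s, hs, has⟩ := hψ z
    have ha : ψ a ≠ 0 := by
      rw [← has]
      exact mul_ne_zero hs hz.ne_zero
    have h1 := hres (hmul (hC hs) hf) (hC ha)
      (by rw [Polynomial.map_mul, ← hzf, map_C, map_C, ← C_mul, has])
    rw [D.res_mul (hC hs) hf, ← eq_sub_iff_add_eq'] at h1
    rw [h1]
    exact sub_mem (hcl ha) (hcl hs)
  induction hn : (f.map ψ).natDegree using Nat.strong_induction_on generalizing f g with
  | _ n ih =>
  by_cases hirr : ∀ π, Irreducible π → ¬ π ∣ f.map ψ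
  · exact sub_mem (hdeg hf hirr) (hdeg hg fun π hπ hd =>
      hirr π hπ (hpos hg hf (fun q hq => (hord q hq).symm) π hπ hd))
  · push Not at hirr
    obtain ⟨π, hπ, hd⟩ := hirr
    obtain ⟨y, hy⟩ := hpos hf hg hord π hπ hd
    obtain ⟨x, hx⟩ := hd
    obtain ⟨s, hs, P, hP⟩ := exists_map_eq_C_mul hψ π
    obtain ⟨t, ht, F, hF⟩ := exists_map_eq_C_mul hψ x
    obtain ⟨t', ht', F', hF'⟩ := exists_map_eq_C_mul hψ y
    have hx0 : x ≠ 0 := fun h => hmap.1 hf (by rw [hx, h, mul_zero])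
    have hy0 : y ≠ 0 := fun h => hmap.1 hg (by rw [hy, h, mul_zero])
    have hPn : P ∉ p.mapC.1.asIdeal := hmap.2 (by
      rw [hP]
      exact mul_ne_zero (C_ne_zero.2 hs) hπ.ne_zero)
    have hFn : F ∉ p.mapC.1.asIdeal := hmap.2 (by
      rw [hF]
      exact mul_ne_zero (C_ne_zero.2 ht) hx0)
    have hFn' : F' ∉ p.mapC.1.asIdeal := hmap.2 (by
      rw [hF']
      exact mul_ne_zero (C_ne_zero.2 ht') hy0)
    have h1 := hres (hmul (hC hs) (hmul (hC ht) hf)) (hmul hPn hFn) (by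
      rw [Polynomial.map_mul, Polynomial.map_mul, Polynomial.map_mul, hx, hP, hF, map_C, map_C]
      ring)
    have h2 := hres (hmul (hC hs) (hmul (hC ht') hg)) (hmul hPn hFn') (by
      rw [Polynomial.map_mul, Polynomial.map_mul, Polynomial.map_mul, hy, hP, hF', map_C, map_C]
      ring)
    rw [D.res_mul (hC hs) (hmul (hC ht) hf), D.res_mul (hC ht) hf, D.res_mul hPn hFn] at h1
    rw [D.res_mul (hC hs) (hmul (hC ht') hg), D.res_mul (hC ht') hg, D.res_mul hPn hFn'] at h2
    have h3 : D.res p.mapC f - D.res p.mapC g = (D.res p.mapC F - D.res p.mapC F') +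
        (D.res p.mapC (C t') - D.res p.mapC (C t)) := by
      have := congrArg₂ (· - ·) h1 h2
      rw [add_sub_add_left_eq_sub, add_sub_add_left_eq_sub] at this
      rw [← this]
      abel
    rw [h3]
    refine add_mem (ih _ ?_ hFn hFn' (fun q hq => ?_) rfl) (sub_mem (hcl ht') (hcl ht))
    · rw [← hn, hF, hx, natDegree_C_mul ht, natDegree_mul hπ.ne_zero hx0]
      have := hπ.natDegree_pos
      omega
    · have h4 := congrArg (D.ord p.mapC q) h3
      have hCq : ∀ {a}, ψ a ≠ 0 → C a ∉ q.1.asIdeal := fun ha => by rwa [hq, ← hker]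
      rw [map_sub, map_add, map_sub, map_sub, hord q hq, D.ord_of_notMem (hC ht) (hCq ht),
        D.ord_of_notMem (hC ht') (hCq ht')] at h4
      omega

end ResidueField

/-- Exactness of the Gersten complex of `K₂` modulo constants: for all Gersten data on `R`, an
element with trivial tame symbols is a combination of symbols of constants, and a finitely
supported family of unit classes with trivial divisor is the family of tame symbols of an
element. -/
def GerstenExact (k R : Type) [Field k] [CommRing R] [Algebra k R] : Prop :=
  ∀ (K : Type) [AddCommGroup K] (G : H1 R → Type) [∀ p, AddCommGroup (G p)]
    (D : GerstenData R K G),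
    (∀ ξ ∈ D.symSpan Set.univ, (∀ p, D.tame p ξ = 0) →
      ξ ∈ D.symSpan (Set.range (algebraMap k R))) ∧
    (∀ u : ∀ p, G p, (∀ p, u p ∈ D.unitClasses p) → {p | u p ≠ 0}.Finite →
      (∀ q, ∑ᶠ p, D.ord p q (u p) = 0) → ∃ ξ ∈ D.symSpan Set.univ, ∀ p, D.tame p ξ = u p)

section Exactness

variable {k R : Type} [Field k] [CommRing R]

theorem GerstenExact.of_surjective [IsDomain R] [UniqueFactorizationMonoid R] [Algebra k R]
    (h : Function.Surjective (algebraMap k R)) : GerstenExact k R := by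
  have hH : IsEmpty (H1 R) := ⟨fun p => by
    obtain ⟨π, hπ, -⟩ := p.exists_prime
    obtain ⟨c, rfl⟩ := h π
    have hc : c ≠ 0 := by
      rintro rfl
      exact hπ.ne_zero (map_zero _)
    exact hπ.not_isUnit ((isUnit_iff_ne_zero.2 hc).map _)⟩
  intro K _ G _ D
  refine ⟨fun ξ hξ _ => ?_, fun u _ _ _ => ⟨0, zero_mem _, fun p => isEmptyElim p⟩⟩
  rwa [h.range_eq]

variable [IsNoetherianRing R]

theorem H1.mapC_injective : Function.Injective (H1.mapC : H1 R → H1 R[X]) := by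
  intro p p' h
  ext a
  have := congrArg (fun p : H1 R[X] => C a ∈ p.1.asIdeal) h
  simpa [H1.mapC, Ideal.C_mem_map_C_iff] using this

variable [IsDomain R] [UniqueFactorizationMonoid R]

theorem H1.exists_eq_mapC {p : H1 R[X]} (hp : p.deg = 0) : ∃ p' : H1 R, p = p'.mapC := by
  have h := p.prime_gen
  rw [eq_C_of_natDegree_eq_zero hp, Polynomial.prime_C_iff] at h
  refine ⟨H1.ofPrime h, H1.ext ?_⟩
  rw [p.asIdeal_eq]
  simp only [H1.mapC, H1.ofPrime, Ideal.map_span, Set.image_singleton]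
  rw [← eq_C_of_natDegree_eq_zero hp]

namespace GerstenData

variable {K : Type} [AddCommGroup K] {G : H1 R[X] → Type} [∀ p, AddCommGroup (G p)]
  (D : GerstenData R[X] K G)

theorem mem_restrictC_unitClasses {w : ∀ p, G p} (hw : ∀ p, w p ∈ D.unitClasses p)
    (h0 : ∀ p : H1 R[X], 0 < p.deg → w p = 0) (hord : ∀ q, ∑ᶠ p, D.ord p q (w p) = 0)
    (p : H1 R) : w p.mapC ∈ D.restrictC.unitClasses p := by
  obtain ⟨f, g, hf, hg, hfg⟩ := D.mem_unitClasses (hw p.mapC)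
  rw [hfg]
  set ψ := (algebraMap (R ⧸ p.1.asIdeal) (FractionRing (R ⧸ p.1.asIdeal))).comp
    (Ideal.Quotient.mk p.1.asIdeal) with hψ
  have hker : ∀ a, ψ a = 0 ↔ a ∈ p.1.asIdeal := fun a => by
    simp [hψ, Ideal.Quotient.eq_zero_iff_mem]
  refine D.res_sub_res_mem_unitClasses (ψ := ψ) hker (fun z => ?_) hf hg fun q hq => ?_
  · obtain ⟨a, s, hs, h⟩ := IsFractionRing.div_surjective (A := R ⧸ p.1.asIdeal) z
    obtain ⟨a, rfl⟩ := Ideal.Quotient.mk_surjective a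
    obtain ⟨s, rfl⟩ := Ideal.Quotient.mk_surjective s
    have hs' : ψ s ≠ 0 := by simpa [hψ] using nonZeroDivisors.ne_zero hs
    exact ⟨a, s, hs', by rw [← h]; exact mul_div_cancel₀ _ hs'⟩
  · have h := hord q
    rw [finsum_eq_single _ p.mapC, hfg, map_sub, sub_eq_zero] at h
    · exact h
    · intro p' hne
      by_cases hp' : 0 < p'.deg
      · rw [h0 p' hp', map_zero]
      · obtain ⟨p'', rfl⟩ := H1.exists_eq_mapC (by omega : p'.deg = 0)
        refine D.ord_eq_zero_of_not_le (fun hle => hne ?_) (hw _)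
        rw [H1.eq_of_le (p := p'') (p' := p) fun a ha =>
          (hq a).1 (hle (Ideal.mem_map_of_mem _ ha))]

theorem exists_tame_eq_of_pos_deg {u : ∀ p, G p} (hu : ∀ p, u p ∈ D.unitClasses p)
    (hfin : {p | u p ≠ 0}.Finite) :
    ∃ ξ ∈ D.symSpan Set.univ, ∀ p : H1 R[X], 0 < p.deg → D.tame p ξ = u p := by
  classical
  have hη : ∀ p : H1 R[X], ∃ ξ ∈ D.symSpan Set.univ, 0 < p.deg → D.tame p ξ = u p ∧
      ∀ p' : H1 R[X], 0 < p'.deg → p' ≠ p → D.tame p' ξ = 0 := fun p => by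
    by_cases hp : 0 < p.deg
    · obtain ⟨ξ, hξ, h⟩ := D.exists_tame_eq_single p hp _ (hu p)
      exact ⟨ξ, hξ, fun _ => h⟩
    · exact ⟨0, zero_mem _, fun h => absurd h hp⟩
  choose η hη hη' using hη
  set t := hfin.toFinset.filter fun p => 0 < p.deg with ht
  refine ⟨∑ p ∈ t, η p, sum_mem fun p _ => hη p, fun p hp => ?_⟩
  rw [map_sum]
  by_cases hpt : p ∈ t
  · rw [Finset.sum_eq_single p, (hη' p hp).1]
    · exact fun p' hp' hne => (hη' p' (Finset.mem_filter.1 hp').2).2 p hp hne.symm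
    · exact fun h => absurd hpt h
  · rw [Finset.sum_eq_zero]
    · by_contra h
      exact hpt (Finset.mem_filter.2 ⟨hfin.mem_toFinset.2 (Ne.symm h), hp⟩)
    · exact fun p' hp' => (hη' p' (Finset.mem_filter.1 hp').2).2 p hp fun h => hpt (h ▸ hp')

end GerstenData

theorem GerstenExact.polynomial [Algebra k R] (h : GerstenExact k R) : GerstenExact k R[X] := by
  intro K _ G _ D
  obtain ⟨hinj, hsurj⟩ := h K _ D.restrictC
  refine ⟨fun ξ hξ h0 => ?_, fun u hu hfin hord => ?_⟩
  · have h1 := D.mem_filt_zero hξ fun p _ => h0 p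
    rw [D.filt_zero_eq] at h1
    refine (D.restrictC.symSpan_le ?_) (hinj ξ h1 fun p => h0 p.mapC)
    rintro _ ⟨a, rfl⟩ _ ⟨b, rfl⟩ ha hb
    exact D.sym_mem_symSpan ⟨a, rfl⟩ ⟨b, rfl⟩ (C_ne_zero.2 ha) (C_ne_zero.2 hb)
  · obtain ⟨ξ, hξ, hξu⟩ := D.exists_tame_eq_of_pos_deg hu hfin
    obtain ⟨hfin', hunit', hord'⟩ := D.symSpan_univ_le_cycleSubgroup hξ
    set w : ∀ p, G p := fun p => u p - D.tame p ξ with hw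
    have hwfin : {p | w p ≠ 0}.Finite := (hfin.union hfin').subset fun p hp => by
      by_contra hc
      simp only [Set.mem_union, Set.mem_ofPred_eq, not_or, not_not] at hc
      exact hp (by simp only [hw]; rw [hc.1, hc.2, sub_zero])
    have hwunit : ∀ p, w p ∈ D.unitClasses p := fun p => sub_mem (hu p) (hunit' p)
    have hw0 : ∀ p : H1 R[X], 0 < p.deg → w p = 0 := fun p hp => sub_eq_zero.2 (hξu p hp).symm
    have hword : ∀ q, ∑ᶠ p, D.ord p q (w p) = 0 := by
      intro q
      simp only [hw, map_sub]
      rw [finsum_sub_distrib, hord, hord', sub_zero]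
      · exact hfin.subset fun p hp hc => hp (by simp [hc])
      · exact hfin'.subset fun p hp hc => hp (by simp [hc])
    obtain ⟨ξ', hξ', hξw⟩ := hsurj (fun p => w p.mapC)
      (D.mem_restrictC_unitClasses hwunit hw0 hword)
      (hwfin.preimage H1.mapC_injective.injOn) fun q => by
        rw [← hword q.mapC]
        refine (finsum_mem_range (f := fun p => D.ord p q.mapC (w p))
          H1.mapC_injective).symm.trans ?_
        rw [← finsum_mem_univ (fun p => D.ord p q.mapC (w p))]
        refine finsum_mem_inter_support_eq' _ _ _ fun p hp => ?_
        simp only [Set.mem_range, Set.mem_univ, iff_true]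
        by_cases hd : 0 < p.deg
        · exact absurd (by simp [hw0 p hd]) hp
        · obtain ⟨p', rfl⟩ := H1.exists_eq_mapC (by omega : p.deg = 0)
          exact ⟨p', rfl⟩
    rw [← D.filt_zero_eq] at hξ'
    have hle : D.filt 0 ≤ D.symSpan Set.univ := D.symSpan_mono (Set.subset_univ _)
    refine ⟨ξ + ξ', add_mem hξ (hle hξ'), fun p => ?_⟩
    rw [map_add]
    by_cases hd : 0 < p.deg
    · rw [hξu p hd, D.tame_eq_zero_of_mem_filt hd hξ', add_zero]
    · obtain ⟨p', rfl⟩ := H1.exists_eq_mapC (by omega : p.deg = 0)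
      have : D.tame p'.mapC ξ' = w p'.mapC := hξw p'
      rw [this, hw, add_sub_cancel]

end Exactness

section RingEquiv

variable {R S : Type} [CommRing R] [CommRing S] (e : R ≃+* S)

/-- The bijection of height-one primes induced by a ring isomorphism. -/
def H1.mapEquiv (p : H1 R) : H1 S :=
  ⟨⟨p.1.asIdeal.map e, Ideal.map_isPrime_of_equiv e⟩, by
    rw [← PrimeSpectrum.height_eq_orderHeight]
    simp only
    rw [RingEquiv.height_map, PrimeSpectrum.height_eq_orderHeight, p.2]⟩

/-- The bijection of height-two primes induced by a ring isomorphism. -/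
def H2.mapEquiv (p : H2 R) : H2 S :=
  ⟨⟨p.1.asIdeal.map e, Ideal.map_isPrime_of_equiv e⟩, by
    rw [← PrimeSpectrum.height_eq_orderHeight]
    simp only
    rw [RingEquiv.height_map, PrimeSpectrum.height_eq_orderHeight, p.2]⟩

theorem H1.mem_mapEquiv {p : H1 R} {a : R} :
    e a ∈ (p.mapEquiv e).1.asIdeal ↔ a ∈ p.1.asIdeal := by
  refine ⟨fun h => ?_, fun h => Ideal.mem_map_of_mem e h⟩
  obtain ⟨b, hb, hab⟩ := (Ideal.mem_map_of_equiv e _).1 h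
  rwa [← e.injective hab]

theorem H2.mem_mapEquiv {p : H2 R} {a : R} :
    e a ∈ (p.mapEquiv e).1.asIdeal ↔ a ∈ p.1.asIdeal := by
  refine ⟨fun h => ?_, fun h => Ideal.mem_map_of_mem e h⟩
  obtain ⟨b, hb, hab⟩ := (Ideal.mem_map_of_equiv e _).1 h
  rwa [← e.injective hab]

theorem H1.mapEquiv_bijective : Function.Bijective (H1.mapEquiv e) := by
  refine ⟨fun p p' h => ?_, fun p => ⟨p.mapEquiv e.symm, ?_⟩⟩
  · ext a
    rw [← H1.mem_mapEquiv e, h, H1.mem_mapEquiv e]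
  · ext a
    obtain ⟨a, rfl⟩ := e.surjective a
    rw [H1.mem_mapEquiv e]
    conv_lhs => rw [← e.symm_apply_apply a]
    rw [H1.mem_mapEquiv e.symm]

end RingEquiv

theorem GerstenExact.of_algEquiv {k R S : Type} [Field k] [CommRing R] [CommRing S] [Algebra k R]
    [Algebra k S] (e : R ≃ₐ[k] S) (h : GerstenExact k R) : GerstenExact k S := by
  intro K _ G _ D
  set φ : R ≃+* S := e.toRingEquiv
  have hm := H1.mapEquiv_bijective φ
  set m := Equiv.ofBijective _ hm
  set D' := D.comap (φ : R →+* S) φ.injective (H1.mapEquiv φ) (H2.mapEquiv φ) (fun _ => rfl)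
    (fun _ _ => H1.mem_mapEquiv φ) (fun _ => rfl) (fun _ _ => H2.mem_mapEquiv φ) with hD'
  have hspan : D'.symSpan Set.univ = D.symSpan Set.univ := by
    apply le_antisymm
    · exact D'.symSpan_le fun a _ b _ ha hb => D.sym_mem_symSpan (Set.mem_univ (φ a))
        (Set.mem_univ (φ b)) ((map_ne_zero_iff φ φ.injective).2 ha)
        ((map_ne_zero_iff φ φ.injective).2 hb)
    · refine D.symSpan_le fun a _ b _ ha hb => ?_
      obtain ⟨a, rfl⟩ := φ.surjective a
      obtain ⟨b, rfl⟩ := φ.surjective b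
      exact D'.sym_mem_symSpan (Set.mem_univ a) (Set.mem_univ b)
        ((map_ne_zero_iff φ φ.injective).1 ha) ((map_ne_zero_iff φ φ.injective).1 hb)
  have hunit : ∀ p, D'.unitClasses p = D.unitClasses (p.mapEquiv φ) := by
    intro p
    apply le_antisymm
    · rw [GerstenData.unitClasses, AddSubgroup.closure_le]
      rintro _ ⟨a, ha, rfl⟩
      exact D.res_mem_unitClasses (mt (H1.mem_mapEquiv φ).1 ha)
    · rw [GerstenData.unitClasses, AddSubgroup.closure_le]
      rintro _ ⟨a, ha, rfl⟩
      obtain ⟨a, rfl⟩ := φ.surjective a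
      exact D'.res_mem_unitClasses (mt (H1.mem_mapEquiv φ).2 ha)
  obtain ⟨hinj, hsurj⟩ := h K _ D'
  refine ⟨fun ξ hξ h0 => ?_, fun u hu hfin hord => ?_⟩
  · refine (D'.symSpan_le ?_) (hinj ξ (hspan ▸ hξ) fun p => h0 _)
    rintro _ ⟨a, rfl⟩ _ ⟨b, rfl⟩ ha hb
    exact D.sym_mem_symSpan ⟨a, (e.commutes a).symm⟩ ⟨b, (e.commutes b).symm⟩
      ((map_ne_zero_iff φ φ.injective).2 ha) ((map_ne_zero_iff φ φ.injective).2 hb)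
  · obtain ⟨ξ, hξ, hu'⟩ := hsurj (fun p => u (p.mapEquiv φ)) (fun p => hunit p ▸ hu _)
      (hfin.preimage hm.1.injOn) fun q => by
        rw [← hord (q.mapEquiv φ)]
        exact finsum_comp_equiv m (f := fun p => D.ord p (q.mapEquiv φ) (u p))
    refine ⟨ξ, hspan ▸ hξ, fun p => ?_⟩
    obtain ⟨p, rfl⟩ := hm.2 p
    exact hu' p

theorem GerstenExact.mvPolynomial (k : Type) [Field k] (n : ℕ) :
    GerstenExact k (MvPolynomial (Fin n) k) := by
  induction n with
  | zero =>
    have e := MvPolynomial.isEmptyAlgEquiv k (Fin 0)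
    exact .of_surjective fun f => ⟨e f, (e.symm.commutes (e f)).symm.trans (e.symm_apply_apply f)⟩
  | succ n ih => exact ih.polynomial.of_algEquiv (MvPolynomial.finSuccEquiv k n).symm

end GerstenComplexes

section MilnorSymbols

namespace MilnorK2

variable {F : Type} [Field F]

theorem symbol_mul_left (f g h : Fˣ) : symbol (f * g) h = symbol f h + symbol g h := by
  simp only [symbol, ofMul_mul, TensorProduct.add_tmul, Submodule.Quotient.mk_add]

theorem symbol_mul_right (f g h : Fˣ) : symbol f (g * h) = symbol f g + symbol f h := by
  simp only [symbol, ofMul_mul, TensorProduct.tmul_add, Submodule.Quotient.mk_add]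

/-- The symbol as a homomorphism in its first entry. -/
noncomputable def symbolLeft (g : Fˣ) : Additive Fˣ →+ MilnorK2 F :=
  AddMonoidHom.mk' (fun f => symbol f.toMul g) fun a b => symbol_mul_left a.toMul b.toMul g

/-- The symbol as a homomorphism in its second entry. -/
noncomputable def symbolRight (f : Fˣ) : Additive Fˣ →+ MilnorK2 F :=
  AddMonoidHom.mk' (fun g => symbol f g.toMul) fun a b => symbol_mul_right f a.toMul b.toMul

theorem symbol_one_left (g : Fˣ) : symbol 1 g = 0 := map_zero (symbolLeft g)

theorem symbol_inv_left (f g : Fˣ) : symbol f⁻¹ g = -symbol f g :=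
  map_neg (symbolLeft g) (Additive.ofMul f)

theorem symbol_inv_right (f g : Fˣ) : symbol f g⁻¹ = -symbol f g :=
  map_neg (symbolRight f) (Additive.ofMul g)

theorem symbol_of_add_eq_one {f g : Fˣ} (h : (f : F) + g = 1) : symbol f g = 0 := by
  have hg : (g : F) = 1 - f := by rw [← h, add_sub_cancel_left]
  have h0 : (1 : F) - f ≠ 0 := hg ▸ g.ne_zero
  have : g = Units.mk0 ((1 : F) - f) h0 := Units.ext hg
  rw [this]
  exact (Submodule.Quotient.mk_eq_zero _).2 (Submodule.subset_span ⟨f, h0, rfl⟩)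

theorem symbol_neg_self (f : Fˣ) : symbol f (-f) = 0 := by
  by_cases hf : f = 1
  · rw [hf, symbol_one_left]
  have h1 : (1 : F) - f ≠ 0 := fun h => hf (Units.ext (sub_eq_zero.1 h).symm)
  have h2 : (1 : F) - (f⁻¹ : Fˣ) ≠ 0 := fun h =>
    hf (inv_eq_one.1 (Units.ext (sub_eq_zero.1 h).symm))
  have key : -f = Units.mk0 _ h1 * (Units.mk0 _ h2)⁻¹ := by
    rw [eq_mul_inv_iff_mul_eq]
    ext
    simp [mul_sub]
  rw [key, symbol_mul_right, symbol_inv_right, ← symbol_inv_left,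
    symbol_of_add_eq_one (by simp), symbol_of_add_eq_one (by simp), add_zero]

theorem symbol_self (f : Fˣ) : symbol f f = symbol f (-1) := by
  calc symbol f f = symbol f (-1 * -f) := by simp
    _ = symbol f (-1) := by rw [symbol_mul_right, symbol_neg_self, add_zero]

theorem symbol_swap (f g : Fˣ) : symbol f g = -symbol g f := by
  have h := symbol_neg_self (f * g)
  have h1 : symbol f (-(f * g)) = symbol f g := by
    rw [← neg_mul, symbol_mul_right, symbol_neg_self, zero_add]
  have h2 : symbol g (-(f * g)) = symbol g f := by
    rw [mul_comm f, ← neg_mul, symbol_mul_right, symbol_neg_self, zero_add]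
  rw [symbol_mul_left, h1, h2] at h
  exact eq_neg_of_add_eq_zero_left h

theorem symbol_add {f g h : Fˣ} (hfg : (f : F) + g = h) :
    symbol f g = symbol f h + symbol h g - symbol h h := by
  have key : symbol (f * h⁻¹) (g * h⁻¹) = 0 := symbol_of_add_eq_one <| by
    rw [Units.val_mul, Units.val_mul, ← add_mul, hfg, Units.mul_inv]
  rw [symbol_mul_left, symbol_mul_right, symbol_mul_right, symbol_inv_left, symbol_inv_left,
    symbol_inv_right, symbol_inv_right] at key
  rw [← sub_eq_zero, ← key]
  abel

theorem closure_symbol : AddSubgroup.closure {x | ∃ f g : Fˣ, x = symbol f g} = ⊤ := by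
  rw [eq_top_iff]
  rintro x -
  obtain ⟨t, rfl⟩ := Submodule.Quotient.mk_surjective _ x
  induction t using TensorProduct.induction_on with
  | zero => exact zero_mem _
  | tmul f g => exact AddSubgroup.subset_closure ⟨f.toMul, g.toMul, rfl⟩
  | add a b ha hb => exact add_mem ha hb

end MilnorK2

end MilnorSymbols

section LengthOfQuotients

/-- The ideals above `J` which are contracted from the localization at the prime `q`. -/
abbrev SaturatedIdeal {R : Type} [CommRing R] (q J : Ideal R) : Type :=
  {I : Ideal R // J ≤ I ∧ ∀ s x, s ∉ q → s * x ∈ I → x ∈ I}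

variable {R : Type} [CommRing R]

/-- Ideals of `(R/p)_q` above `c` are the saturated ideals of `R` above `p + (c)`. -/
noncomputable def saturatedIdealEquiv {p q : Ideal R} (hpq : p ≤ q)
    [hQ : (q.map (Ideal.Quotient.mk p)).IsPrime] (c : R) :
    Set.Ici (Ideal.span {algebraMap (R ⧸ p) (Localization.AtPrime (q.map (Ideal.Quotient.mk p)))
      (Ideal.Quotient.mk p c)}) ≃o SaturatedIdeal q (p ⊔ Ideal.span {c}) := by
  let Q := q.map (Ideal.Quotient.mk p)
  let ψ : R →+* Localization.AtPrime Q :=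
    (algebraMap (R ⧸ p) (Localization.AtPrime Q)).comp (Ideal.Quotient.mk p)
  have hmem : ∀ s, Ideal.Quotient.mk p s ∈ Q ↔ s ∈ q := fun s => by
    simp only [Q]
    rw [Ideal.mem_quotient_iff_mem hpq]
  have hunit : ∀ s, s ∉ q → IsUnit (ψ s) := fun s hs =>
    IsLocalization.map_units (Localization.AtPrime Q)
      (⟨Ideal.Quotient.mk p s, fun h => hs ((hmem s).1 h)⟩ : Q.primeCompl)
  have hfrac : ∀ b : Localization.AtPrime Q, ∃ r s, s ∉ q ∧ b * ψ s = ψ r := fun b => by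
    obtain ⟨⟨a, s⟩, h⟩ := IsLocalization.surj Q.primeCompl b
    obtain ⟨r, rfl⟩ := Ideal.Quotient.mk_surjective a
    obtain ⟨t, ht⟩ := Ideal.Quotient.mk_surjective s.1
    refine ⟨r, t, fun h' => s.2 (ht ▸ (hmem t).2 h'), ?_⟩
    simpa only [ψ, RingHom.comp_apply, ht] using h
  refine RelIso.ofSurjective (OrderEmbedding.ofMapLEIff
    (fun I : Set.Ici (Ideal.span {algebraMap (R ⧸ p) (Localization.AtPrime Q)
      (Ideal.Quotient.mk p c)}) =>
      (⟨I.1.comap ψ, ?_, ?_⟩ : SaturatedIdeal q (p ⊔ Ideal.span {c}))) ?_) ?_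
  · rw [sup_le_iff, Ideal.span_singleton_le_iff_mem]
    refine ⟨fun x hx => ?_, I.2 (Ideal.mem_span_singleton_self _)⟩
    rw [Ideal.mem_comap, RingHom.comp_apply, Ideal.Quotient.eq_zero_iff_mem.2 hx, map_zero]
    exact zero_mem _
  · intro s x hs hx
    rw [Ideal.mem_comap, map_mul] at hx
    exact (Ideal.unit_mul_mem_iff_mem _ (hunit s hs)).1 hx
  · intro I I'
    refine ⟨fun h b hb => ?_, fun h => Ideal.comap_mono h⟩
    obtain ⟨r, s, hs, hr⟩ := hfrac b
    have : r ∈ I.1.comap ψ := by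
      rw [Ideal.mem_comap, ← hr]
      exact Ideal.mul_mem_right _ _ hb
    have h' := h this
    rw [Ideal.mem_comap, ← hr] at h'
    exact (Ideal.mul_unit_mem_iff_mem _ (hunit s hs)).1 h'
  · rintro ⟨J, hJ, hsat⟩
    rw [sup_le_iff, Ideal.span_singleton_le_iff_mem] at hJ
    refine ⟨⟨J.map ψ, ?_⟩, Subtype.ext (le_antisymm (fun r hr => ?_) Ideal.le_comap_map)⟩
    · exact (Ideal.span_singleton_le_iff_mem _).2 (Ideal.mem_map_of_mem ψ hJ.2)
    · have hr' : ψ r ∈ J.map ψ := hr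
      rw [← Ideal.map_map, RingHom.comp_apply,
        IsLocalization.algebraMap_mem_map_algebraMap_iff Q.primeCompl] at hr'
      obtain ⟨m, hm, hmr⟩ := hr'
      obtain ⟨t, rfl⟩ := Ideal.Quotient.mk_surjective m
      rw [← map_mul, Ideal.mem_quotient_iff_mem hJ.1] at hmr
      exact hsat t r (fun h' => hm ((hmem t).2 h')) hmr

theorem lengthQuot_eq_krullDim {p q : Ideal R} (hpq : p ≤ q)
    (hQ : (q.map (Ideal.Quotient.mk p)).IsPrime) (c : R) :
    lengthQuot _ hQ (Ideal.Quotient.mk p c) =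
      Order.krullDim (SaturatedIdeal q (p ⊔ Ideal.span {c})) := by
  have := hQ
  exact Order.krullDim_eq_of_orderIso
    ((Submodule.comapMkQRelIso _).trans (saturatedIdealEquiv hpq c))

theorem lengthQuot_eq_zero {p q : Ideal R} (hpq : p ≤ q)
    (hQ : (q.map (Ideal.Quotient.mk p)).IsPrime) {c : R} (hc : c ∉ q) :
    lengthQuot _ hQ (Ideal.Quotient.mk p c) = 0 := by
  rw [lengthQuot_eq_krullDim hpq]
  have htop : ∀ I : SaturatedIdeal q (p ⊔ Ideal.span {c}), I.1 = ⊤ := fun I => by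
    rw [Ideal.eq_top_iff_one]
    refine I.2.2 c 1 hc ?_
    rw [mul_one]
    exact I.2.1 (le_sup_right (a := p) (Ideal.mem_span_singleton_self c))
  have : Subsingleton (SaturatedIdeal q (p ⊔ Ideal.span {c})) :=
    ⟨fun I I' => Subtype.ext ((htop I).trans (htop I').symm)⟩
  have : Nonempty (SaturatedIdeal q (p ⊔ Ideal.span {c})) :=
    ⟨⟨⊤, le_top, fun _ _ _ _ => trivial⟩⟩
  exact Order.krullDim_eq_zero

theorem lengthQuot_pos {p q : Ideal R} (hq : q.IsPrime) (hpq : p ≤ q)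
    (hQ : (q.map (Ideal.Quotient.mk p)).IsPrime) {c : R} (hc : c ∈ q) :
    0 < lengthQuot _ hQ (Ideal.Quotient.mk p c) := by
  rw [lengthQuot_eq_krullDim hpq, Order.krullDim_pos_iff]
  refine ⟨⟨q, ?_, fun s x hs hx => (hq.mem_or_mem hx).resolve_left hs⟩,
    ⟨⊤, le_top, fun _ _ _ _ => trivial⟩, lt_top_iff_ne_top.2 hq.ne_top⟩
  exact sup_le hpq ((Ideal.span_singleton_le_iff_mem _).2 hc)

theorem lengthQuot_symm {p p' q : Ideal R} (hpq : p ≤ q) (hpq' : p' ≤ q)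
    (hQ : (q.map (Ideal.Quotient.mk p)).IsPrime) (hQ' : (q.map (Ideal.Quotient.mk p')).IsPrime)
    {f g : R} (hf : p = Ideal.span {f}) (hg : p' = Ideal.span {g}) :
    lengthQuot _ hQ (Ideal.Quotient.mk p g) = lengthQuot _ hQ' (Ideal.Quotient.mk p' f) := by
  rw [lengthQuot_eq_krullDim hpq, lengthQuot_eq_krullDim hpq', ← hf, ← hg, sup_comm]

theorem H2.map_mk_isPrime {p : H1 R} {q : H2 R} (h : p.1.asIdeal ≤ q.1.asIdeal) :
    (q.1.asIdeal.map (Ideal.Quotient.mk p.1.asIdeal)).IsPrime :=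
  have := q.1.isPrime
  Ideal.map_isPrime_of_surjective Ideal.Quotient.mk_surjective (by rwa [Ideal.mk_ker])

theorem exists_lengthQuot_eq [IsNoetherianRing R] {p : H1 R} {q : H2 R}
    (h : p.1.asIdeal ≤ q.1.asIdeal)
    (hQ : (q.1.asIdeal.map (Ideal.Quotient.mk p.1.asIdeal)).IsPrime) {c : R}
    (hc : c ∉ p.1.asIdeal) :
    ∃ m : ℕ, lengthQuot _ hQ (Ideal.Quotient.mk p.1.asIdeal c) = (m : ℕ∞) := by
  by_cases hcq : c ∉ q.1.asIdeal
  · exact ⟨0, lengthQuot_eq_zero h hQ hcq⟩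
  rw [not_not] at hcq
  set Q := q.1.asIdeal.map (Ideal.Quotient.mk p.1.asIdeal) with hQdef
  let B := Localization.AtPrime Q
  set x : B := algebraMap (R ⧸ p.1.asIdeal) B (Ideal.Quotient.mk p.1.asIdeal c) with hx
  let ψ : R →+* B := (algebraMap (R ⧸ p.1.asIdeal) B).comp (Ideal.Quotient.mk p.1.asIdeal)
  have : IsNoetherianRing B := IsLocalization.isNoetherianRing Q.primeCompl B inferInstance
  have hmax : (IsLocalRing.maximalIdeal B).comap ψ = q.1.asIdeal := by
    ext r
    rw [Ideal.mem_comap, RingHom.comp_apply, IsLocalization.AtPrime.to_map_mem_maximal_iff B Q,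
      hQdef, Ideal.mem_quotient_iff_mem h]
  have hmin : IsLocalRing.maximalIdeal B ∈ (Ideal.span {x}).minimalPrimes := by
    refine ⟨⟨inferInstance, ?_⟩, ?_⟩
    · rw [Ideal.span_singleton_le_iff_mem]
      exact hmax.ge hcq
    · rintro J ⟨hJ, hxJ⟩ -
      have hle : J.comap ψ ≤ q.1.asIdeal := hmax ▸ Ideal.comap_mono (IsLocalRing.le_maximalIdeal hJ.ne_top)
      have hJp : (J.comap ψ).IsPrime := inferInstance
      have hlt : p.1.asIdeal < J.comap ψ := by
        refine lt_of_le_of_ne (fun r hr => ?_) ?_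
        · rw [Ideal.mem_comap, RingHom.comp_apply, Ideal.Quotient.eq_zero_iff_mem.2 hr, map_zero]
          exact zero_mem _
        · intro he
          exact hc (he ▸ hxJ (Ideal.mem_span_singleton_self x))
      have heq : J.comap ψ = q.1.asIdeal := by
        by_contra hne
        have h1 := p.2
        have h2 := q.2
        rw [← PrimeSpectrum.height_eq_orderHeight] at h1 h2
        have := p.1.isPrime
        have := q.1.isPrime
        have hf2 : q.1.asIdeal.FiniteHeight := by simp [Ideal.finiteHeight_iff, h2]
        have l2 := Ideal.height_strict_mono_of_isPrime_of_isPrime (lt_of_le_of_ne hle hne)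
        have hfJ : (J.comap ψ).FiniteHeight := by
          rw [Ideal.finiteHeight_iff]; right; exact ne_top_of_lt l2
        have l1 := Ideal.height_strict_mono_of_isPrime_of_isPrime hlt
        rw [h1] at l1
        rw [h2] at l2
        have := Order.add_one_le_of_lt l1
        exact absurd (this.trans_lt l2) (by norm_num)
      intro b hb
      obtain ⟨⟨a, s⟩, hs⟩ := IsLocalization.surj Q.primeCompl b
      obtain ⟨r, rfl⟩ := Ideal.Quotient.mk_surjective a
      have hr : r ∈ q.1.asIdeal := hmax ▸ (show ψ r ∈ _ from hs ▸ Ideal.mul_mem_right _ _ hb)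
      rw [← heq] at hr
      refine (Ideal.mul_unit_mem_iff_mem _ (IsLocalization.map_units B s)).1 ?_
      rw [hs]
      exact hr
  have := IsLocalRing.quotient_artinian_of_mem_minimalPrimes_of_isLocalRing _ hmin
  have : IsArtinian B (B ⧸ Ideal.span {x}) :=
    isArtinian_of_surjective_algebraMap (Ideal.Quotient.mk_surjective (I := Ideal.span {x}))
  have hfin : Module.length B (B ⧸ Ideal.span {x}) ≠ ⊤ := Module.length_ne_top
  refine ⟨(Module.length B (B ⧸ Ideal.span {x})).toNat, ?_⟩
  rw [ENat.natCast_toNat hfin, Module.coe_length]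
  rfl

end LengthOfQuotients

section TameComplexes

/-- Valuations, tame symbols, their sum modulo constants, and a divisor map for a domain `R` over
`k`. -/
structure TameComplex (k R : Type) [Field k] [CommRing R] [IsDomain R] [Algebra k R]
    [DecidableEq (H1 R)] where
  /-- the discrete valuation at a height-one prime -/
  ν : H1 R → (FractionRing R)ˣ → ℤ
  ν_mul : ∀ p f g, ν p (f * g) = ν p f + ν p g
  ν_char : ∀ (p : H1 R) (a : R) (u : (FractionRing R)ˣ),
    (u : FractionRing R) = algebraMap _ _ a →
    ∀ m : ℕ, (ν p u = m ↔ a ∈ symbPow p.1 m ∧ a ∉ symbPow p.1 (m + 1))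
  /-- the tame symbol at a height-one prime -/
  tameAt : ∀ p : H1 R, MilnorK2 (FractionRing R) →+ Additive (kappa p.1)ˣ
  tameAt_symbol : ∀ (p : H1 R) (f g : (FractionRing R)ˣ) (a s : R),
    a ∉ p.1.asIdeal → s ∉ p.1.asIdeal →
    ((-1 : FractionRing R) ^ (ν p f * ν p g) * (g : FractionRing R) ^ (ν p f)
        * (f : FractionRing R) ^ (-(ν p g)) = algebraMap _ _ a / algebraMap _ _ s) →
    ∀ u : (kappa p.1)ˣ, (u : kappa p.1) * resid p.1 s = resid p.1 a →
      tameAt p (MilnorK2.symbol f g) = Additive.ofMul u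
  /-- the total tame symbol modulo constants -/
  tameBar : MilnorK2 (FractionRing R) →+ DirectSum (H1 R) (fun p => kappaUnitsModConst k p.1)
  tameBar_apply : ∀ ξ p, tameBar ξ p = QuotientAddGroup.mk (tameAt p ξ)
  /-- the divisor map -/
  dv : DirectSum (H1 R) (fun p => kappaUnitsModConst k p.1) →+ (H2 R →₀ ℤ)
  dv_of : ∀ (p : H1 R) (a b : R), a ∉ p.1.asIdeal → b ∉ p.1.asIdeal →
    ∀ u : (kappa p.1)ˣ, (u : kappa p.1) * resid p.1 b = resid p.1 a →
    ∀ q : H2 R,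
      (¬ p.1.asIdeal ≤ q.1.asIdeal →
        dv (DirectSum.of _ p (QuotientAddGroup.mk (Additive.ofMul u))) q = 0) ∧
      (p.1.asIdeal ≤ q.1.asIdeal →
        ∀ hQ : (Ideal.map (Ideal.Quotient.mk p.1.asIdeal) q.1.asIdeal).IsPrime,
        ∀ ma mb : ℕ,
          lengthQuot _ hQ (Ideal.Quotient.mk p.1.asIdeal a) = (ma : ℕ∞) →
          lengthQuot _ hQ (Ideal.Quotient.mk p.1.asIdeal b) = (mb : ℕ∞) →
          dv (DirectSum.of _ p (QuotientAddGroup.mk (Additive.ofMul u))) q = (ma : ℤ) - (mb : ℤ))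

section Residues

variable {R : Type} [CommRing R]

theorem resid_eq_zero_iff {p : PrimeSpectrum R} {a : R} : resid p a = 0 ↔ a ∈ p.asIdeal := by
  rw [resid, FaithfulSMul.algebraMap_eq_zero_iff, Ideal.Quotient.eq_zero_iff_mem]

theorem resid_mul (p : PrimeSpectrum R) (a b : R) : resid p (a * b) = resid p a * resid p b := by
  simp only [resid, map_mul]

theorem resid_one (p : PrimeSpectrum R) : resid p 1 = 1 := by
  simp only [resid, map_one]

open Classical in
/-- The residue class at `p` as a unit, with junk value `1` on `p`. -/
noncomputable def residUnit (p : PrimeSpectrum R) (a : R) : (kappa p)ˣ :=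
  if h : a ∈ p.asIdeal then 1 else Units.mk0 (resid p a) fun h' => h (resid_eq_zero_iff.1 h')

theorem coe_residUnit {p : PrimeSpectrum R} {a : R} (h : a ∉ p.asIdeal) :
    (residUnit p a : kappa p) = resid p a := by
  rw [residUnit, dif_neg h, Units.val_mk0]

theorem residUnit_mul {p : PrimeSpectrum R} {a b : R} (ha : a ∉ p.asIdeal) (hb : b ∉ p.asIdeal) :
    residUnit p (a * b) = residUnit p a * residUnit p b := by
  have hab : a * b ∉ p.asIdeal := fun h => (p.isPrime.mem_or_mem h).elim ha hb
  ext
  rw [Units.val_mul, coe_residUnit ha, coe_residUnit hb, coe_residUnit hab, resid_mul]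

theorem residUnit_eq_iff {p : PrimeSpectrum R} {a b : R} (ha : a ∉ p.asIdeal)
    (hb : b ∉ p.asIdeal) : residUnit p a = residUnit p b ↔ a - b ∈ p.asIdeal := by
  rw [Units.ext_iff, coe_residUnit ha, coe_residUnit hb, resid, resid,
    (FaithfulSMul.algebraMap_injective (R ⧸ p.asIdeal) (kappa p)).eq_iff,
    Ideal.Quotient.mk_eq_mk_iff_sub_mem]

theorem mem_symbPow_zero (p : PrimeSpectrum R) (a : R) : a ∈ symbPow p 0 := by
  rw [symbPow, pow_zero, Ideal.one_eq_top, Ideal.comap_top]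
  trivial

theorem mem_symbPow_one {p : PrimeSpectrum R} {a : R} : a ∈ symbPow p 1 ↔ a ∈ p.asIdeal := by
  rw [symbPow, pow_one, Localization.AtPrime.map_eq_maximalIdeal, Ideal.mem_comap,
    IsLocalization.AtPrime.to_map_mem_maximal_iff _ p.asIdeal]

theorem exists_residUnit_div {p : PrimeSpectrum R} (u : (kappa p)ˣ) :
    ∃ a b, a ∉ p.asIdeal ∧ b ∉ p.asIdeal ∧ u = residUnit p a / residUnit p b := by
  obtain ⟨x, y, hy, h⟩ := IsFractionRing.div_surjective (A := R ⧸ p.asIdeal) (u : kappa p)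
  obtain ⟨a, rfl⟩ := Ideal.Quotient.mk_surjective x
  obtain ⟨b, rfl⟩ := Ideal.Quotient.mk_surjective y
  have hb : b ∉ p.asIdeal := fun hb =>
    nonZeroDivisors.ne_zero hy (Ideal.Quotient.eq_zero_iff_mem.2 hb)
  have ha : a ∉ p.asIdeal := fun ha => u.ne_zero <| by
    rw [← h, Ideal.Quotient.eq_zero_iff_mem.2 ha, map_zero, zero_div]
  refine ⟨a, b, ha, hb, Units.ext ?_⟩
  rw [Units.val_div_eq_div_val, coe_residUnit ha, coe_residUnit hb, ← h]
  rfl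

variable [IsDomain R]

theorem generator_ne_zero {p : H1 R} {π : R} (h : p.1.asIdeal = Ideal.span {π}) : π ≠ 0 := by
  rintro rfl
  have hp := p.2
  rw [← PrimeSpectrum.height_eq_orderHeight] at hp
  exact Ideal.ne_bot_of_height_eq_one hp (h.trans (by simp))

open Classical in
/-- A nonzero element of a domain as a unit of the fraction field, with junk value `1` at `0`. -/
noncomputable def fracUnit (a : R) : (FractionRing R)ˣ :=
  if h : a = 0 then 1 else
    Units.mk0 (algebraMap R (FractionRing R) a) ((FaithfulSMul.algebraMap_eq_zero_iff _ _).not.2 h)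

theorem coe_fracUnit {a : R} (h : a ≠ 0) :
    (fracUnit a : FractionRing R) = algebraMap R (FractionRing R) a := by
  rw [fracUnit, dif_neg h, Units.val_mk0]

theorem fracUnit_mul {a b : R} (ha : a ≠ 0) (hb : b ≠ 0) :
    fracUnit (a * b) = fracUnit a * fracUnit b := by
  ext
  rw [Units.val_mul, coe_fracUnit ha, coe_fracUnit hb, coe_fracUnit (mul_ne_zero ha hb), map_mul]

theorem fracUnit_neg_one : fracUnit (-1 : R) = -1 := by
  ext
  rw [coe_fracUnit (neg_ne_zero.2 one_ne_zero)]
  simp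

theorem exists_fracUnit_div (u : (FractionRing R)ˣ) :
    ∃ a b : R, a ≠ 0 ∧ b ≠ 0 ∧ u = fracUnit a / fracUnit b := by
  obtain ⟨a, b, hb, h⟩ := IsFractionRing.div_surjective (A := R) (u : FractionRing R)
  have hb := nonZeroDivisors.ne_zero hb
  have ha : a ≠ 0 := fun ha => u.ne_zero <| by rw [← h, ha, map_zero, zero_div]
  refine ⟨a, b, ha, hb, Units.ext ?_⟩
  rw [Units.val_div_eq_div_val, coe_fracUnit ha, coe_fracUnit hb, ← h]

theorem notMem_symbPow_two {p : H1 R} {π : R} (h : p.1.asIdeal = Ideal.span {π}) :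
    π ∉ symbPow p.1 2 := by
  have hπ := generator_ne_zero h
  intro hmem
  set ι := algebraMap R (Localization.AtPrime p.1.asIdeal) with hι
  have h0 : ι π ≠ 0 := fun h0 => hπ <|
    IsLocalization.injective _ p.1.asIdeal.primeCompl_le_nonZeroDivisors (h0.trans (map_zero ι).symm)
  have : IsDomain (Localization.AtPrime p.1.asIdeal) :=
    IsLocalization.isDomain_of_le_nonZeroDivisors _ p.1.asIdeal.primeCompl_le_nonZeroDivisors
  have hmax : ι π ∈ IsLocalRing.maximalIdeal _ :=
    (IsLocalization.AtPrime.to_map_mem_maximal_iff _ p.1.asIdeal π).2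
      (h ▸ Ideal.mem_span_singleton_self π)
  have hpow : Ideal.map ι p.1.asIdeal = Ideal.span {ι π} :=
    (congrArg (Ideal.map ι) h).trans (by rw [Ideal.map_span, Set.image_singleton])
  rw [symbPow, Ideal.mem_comap, ← hι, hpow, Ideal.span_singleton_pow,
    Ideal.mem_span_singleton'] at hmem
  obtain ⟨x, hx⟩ := hmem
  refine (IsLocalRing.mem_maximalIdeal _).1 hmax (IsUnit.of_mul_eq_one x (mul_left_cancel₀ h0 ?_))
  rw [mul_one]
  nth_rw 3 [← hx]
  ring

end Residues

section Constants

variable {k R : Type} [Field k] [CommRing R] [Algebra k R]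

theorem coe_unitsMap_eq_algebraMap (c : kˣ) :
    ((Units.map (algebraMap k (FractionRing R)).toMonoidHom c : (FractionRing R)ˣ) :
      FractionRing R) = algebraMap R (FractionRing R) (algebraMap k R c) :=
  IsScalarTower.algebraMap_apply k R (FractionRing R) c

theorem isUnit_algebraMap_units (c : kˣ) : IsUnit (algebraMap k R c) := c.isUnit.map _

theorem fracUnit_algebraMap [IsDomain R] (c : kˣ) :
    fracUnit (algebraMap k R c) = Units.map (algebraMap k (FractionRing R)).toMonoidHom c := by
  ext
  rw [coe_unitsMap_eq_algebraMap, coe_fracUnit (isUnit_algebraMap_units c).ne_zero]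

theorem residUnit_algebraMap (p : H1 R) (c : kˣ) :
    residUnit p.1 (algebraMap k R c) = Units.map (algebraMap k (kappa p.1)).toMonoidHom c := by
  ext
  rw [coe_residUnit (p.notMem_of_isUnit (isUnit_algebraMap_units c))]
  exact (IsScalarTower.algebraMap_apply k (R ⧸ p.1.asIdeal) (kappa p.1) c).symm

theorem symbol_const_mem [IsDomain R] (f : (FractionRing R)ˣ) (c : kˣ) :
    MilnorK2.symbol f (fracUnit (algebraMap k R c)) ∈ constSymbols k (FractionRing R) :=
  AddSubgroup.subset_closure ⟨f, c, by rw [fracUnit_algebraMap]⟩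

end Constants

namespace TameComplex

section Valuation

variable {k R : Type} [Field k] [CommRing R] [IsDomain R] [Algebra k R] [DecidableEq (H1 R)]
  (T : TameComplex k R)

theorem ν_fracUnit_of_notMem {p : H1 R} {a : R} (ha : a ∉ p.1.asIdeal) :
    T.ν p (fracUnit a) = 0 := by
  have ha0 : a ≠ 0 := fun h => ha (h ▸ zero_mem _)
  exact_mod_cast (T.ν_char p a _ (coe_fracUnit ha0) 0).2
    ⟨mem_symbPow_zero _ _, fun h => ha (mem_symbPow_one.1 h)⟩

theorem ν_fracUnit_generator {p : H1 R} {π : R} (h : p.1.asIdeal = Ideal.span {π}) :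
    T.ν p (fracUnit π) = 1 := by
  exact_mod_cast (T.ν_char p π _ (coe_fracUnit (generator_ne_zero h)) 1).2
    ⟨mem_symbPow_one.2 (h ▸ Ideal.mem_span_singleton_self π), notMem_symbPow_two h⟩

theorem tameAt_of_notMem {p : H1 R} {a b : R} (ha : a ∉ p.1.asIdeal) (hb : b ∉ p.1.asIdeal) :
    T.tameAt p (MilnorK2.symbol (fracUnit a) (fracUnit b)) = 0 := by
  have h1 : (1 : R) ∉ p.1.asIdeal := p.notMem_of_isUnit isUnit_one
  refine T.tameAt_symbol p _ _ 1 1 h1 h1 ?_ 1 (by simp)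
  rw [T.ν_fracUnit_of_notMem ha, T.ν_fracUnit_of_notMem hb]
  simp

theorem tameAt_generator {p : H1 R} {π b : R} (h : p.1.asIdeal = Ideal.span {π})
    (hb : b ∉ p.1.asIdeal) :
    T.tameAt p (MilnorK2.symbol (fracUnit π) (fracUnit b)) =
      Additive.ofMul (residUnit p.1 b) := by
  refine T.tameAt_symbol p _ _ b 1 hb (p.notMem_of_isUnit isUnit_one) ?_ _ ?_
  · rw [T.ν_fracUnit_of_notMem hb, T.ν_fracUnit_generator h,
      coe_fracUnit (a := b) fun h' => hb (h' ▸ zero_mem _)]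
    simp
  · rw [coe_residUnit hb, resid_one, mul_one]

theorem tameAt_symbol_const (p : H1 R) (f : (FractionRing R)ˣ) (c : kˣ) :
    T.tameAt p (MilnorK2.symbol f (Units.map (algebraMap k (FractionRing R)).toMonoidHom c)) =
      Additive.ofMul (Units.map (algebraMap k (kappa p.1)).toMonoidHom (c ^ T.ν p f)) := by
  have hmem : ∀ c : kˣ, algebraMap k R c ∉ p.1.asIdeal := fun c =>
    p.notMem_of_isUnit (isUnit_algebraMap_units c)
  refine T.tameAt_symbol p _ _ (algebraMap k R (c ^ T.ν p f : kˣ)) 1 (hmem _)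
    (p.notMem_of_isUnit isUnit_one) ?_ _ ?_
  · rw [← coe_unitsMap_eq_algebraMap, ← fracUnit_algebraMap c, T.ν_fracUnit_of_notMem (hmem c),
      fracUnit_algebraMap]
    simp
  · rw [← residUnit_algebraMap, coe_residUnit (hmem _), resid_one, mul_one]

/-- The order at `q` of an element of `κ(p)ˣ`. -/
noncomputable def ord (p : H1 R) (q : H2 R) : Additive (kappa p.1)ˣ →+ ℤ :=
  (Finsupp.applyAddHom q).comp <| T.dv.comp <|
    (DirectSum.of (fun p : H1 R => kappaUnitsModConst k p.1) p).comp (QuotientAddGroup.mk' _)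

theorem ord_eq_zero {p : H1 R} {q : H2 R} (h : ¬ p.1.asIdeal ≤ q.1.asIdeal) {a : R}
    (ha : a ∉ p.1.asIdeal) : T.ord p q (Additive.ofMul (residUnit p.1 a)) = 0 :=
  (T.dv_of p a 1 ha (p.notMem_of_isUnit isUnit_one) _
    (by rw [coe_residUnit ha, resid_one, mul_one]) q).1 h

theorem ord_eq_lengthQuot [IsNoetherianRing R] {p : H1 R} {q : H2 R}
    (h : p.1.asIdeal ≤ q.1.asIdeal) {a : R} (ha : a ∉ p.1.asIdeal) :
    ∃ m : ℕ, T.ord p q (Additive.ofMul (residUnit p.1 a)) = m ∧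
      lengthQuot _ (H2.map_mk_isPrime h) (Ideal.Quotient.mk p.1.asIdeal a) = (m : ℕ∞) := by
  obtain ⟨m, hm⟩ := exists_lengthQuot_eq h (H2.map_mk_isPrime h) ha
  refine ⟨m, ?_, hm⟩
  have key := (T.dv_of p a 1 ha (p.notMem_of_isUnit isUnit_one) _
    (by rw [coe_residUnit ha, resid_one, mul_one]) q).2 h (H2.map_mk_isPrime h) m 0 hm
    (lengthQuot_eq_zero h _ (q.notMem_of_isUnit isUnit_one))
  rwa [Nat.cast_zero, sub_zero] at key

theorem ord_eq_zero_of_notMem [IsNoetherianRing R] {p : H1 R} {q : H2 R} {a : R}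
    (ha : a ∉ p.1.asIdeal) (haq : a ∉ q.1.asIdeal) :
    T.ord p q (Additive.ofMul (residUnit p.1 a)) = 0 := by
  by_cases h : p.1.asIdeal ≤ q.1.asIdeal
  · obtain ⟨m, hm, hl⟩ := T.ord_eq_lengthQuot h ha
    rw [lengthQuot_eq_zero h _ haq] at hl
    rw [hm]
    exact_mod_cast hl.symm
  · exact T.ord_eq_zero h ha

theorem dv_apply (x : DirectSum (H1 R) (fun p => kappaUnitsModConst k p.1)) (q : H2 R) :
    T.dv x q = ∑ᶠ p, T.dv (DirectSum.of _ p (x p)) q := by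
  classical
  rw [finsum_eq_sum_of_support_subset (s := DFinsupp.support x)]
  · conv_lhs => rw [← DirectSum.sum_support_of x, map_sum, Finsupp.finsetSum_apply]
  · intro p hp
    simp only [SetLike.mem_coe, DFinsupp.mem_support_toFun]
    rintro h0
    refine hp ?_
    have h0' : x p = 0 := h0
    simp only [h0', map_zero, Finsupp.coe_zero, Pi.zero_apply]

theorem dv_apply_eq_ord {x : DirectSum (H1 R) (fun p => kappaUnitsModConst k p.1)}
    {u : ∀ p : H1 R, Additive (kappa p.1)ˣ} (h : ∀ p, x p = QuotientAddGroup.mk (u p)) (q : H2 R) :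
    T.dv x q = ∑ᶠ p, T.ord p q (u p) := by
  rw [T.dv_apply]
  exact finsum_congr fun p => by rw [h p]; rfl

theorem constSymbols_le_ker : constSymbols k (FractionRing R) ≤ T.tameBar.ker := by
  rw [constSymbols, AddSubgroup.closure_le]
  rintro _ ⟨f, c, rfl⟩
  rw [SetLike.mem_coe, AddMonoidHom.mem_ker]
  refine DFinsupp.ext fun p => ?_
  refine (T.tameBar_apply _ p).trans ((QuotientAddGroup.eq_zero_iff _).2 ?_)
  rw [T.tameAt_symbol_const]
  exact ⟨_, rfl⟩

end Valuation

section Gersten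

variable {k R : Type} [Field k] [CommRing R] [IsDomain R] [IsNoetherianRing R] [Algebra k R]
  [DecidableEq (H1 R)] (T : TameComplex k R)

/-- The formal Gersten complex underlying a tame complex. -/
noncomputable def gerstenData :
    GerstenData R (MilnorK2 (FractionRing R)) (fun p => Additive (kappa p.1)ˣ) where
  sym a b := MilnorK2.symbol (fracUnit a) (fracUnit b)
  sym_mul_left ha hb _ := by rw [fracUnit_mul ha hb, MilnorK2.symbol_mul_left]
  sym_swap _ _ := MilnorK2.symbol_swap _ _
  sym_self _ := by rw [fracUnit_neg_one, MilnorK2.symbol_self]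
  sym_add ha hb hab := MilnorK2.symbol_add <| by
    rw [coe_fracUnit ha, coe_fracUnit hb, coe_fracUnit hab, map_add]
  tame := T.tameAt
  res p a := Additive.ofMul (residUnit p.1 a)
  res_mul ha hb := by rw [residUnit_mul ha hb, ofMul_mul]
  res_eq_iff ha hb := by rw [Additive.ofMul.apply_eq_iff_eq, residUnit_eq_iff ha hb]
  tame_of_notMem := T.tameAt_of_notMem
  tame_generator := T.tameAt_generator
  ord := T.ord
  ord_of_not_le h _ ha := T.ord_eq_zero h ha
  ord_of_notMem := T.ord_eq_zero_of_notMem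
  ord_pos {p q a} h ha haq := by
    obtain ⟨m, hm, hl⟩ := T.ord_eq_lengthQuot h ha
    have hpos := lengthQuot_pos q.1.isPrime h (H2.map_mk_isPrime h) haq
    rw [hl] at hpos
    rw [hm]
    exact_mod_cast hpos
  ord_symm {p p' q f g} hne hf hg := by
    have hgp : g ∉ p.1.asIdeal := fun h => hne <| Eq.symm <| H1.eq_of_le <|
      hg ▸ (Ideal.span_singleton_le_iff_mem _).2 h
    have hfp : f ∉ p'.1.asIdeal := fun h => hne <| H1.eq_of_le <|
      hf ▸ (Ideal.span_singleton_le_iff_mem _).2 h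
    by_cases hp : p.1.asIdeal ≤ q.1.asIdeal <;> by_cases hp' : p'.1.asIdeal ≤ q.1.asIdeal
    · obtain ⟨m, hm, hl⟩ := T.ord_eq_lengthQuot hp hgp
      obtain ⟨m', hm', hl'⟩ := T.ord_eq_lengthQuot hp' hfp
      rw [lengthQuot_symm hp hp' _ (H2.map_mk_isPrime hp') hf hg, hl'] at hl
      rw [hm, hm']
      exact_mod_cast hl.symm
    · rw [T.ord_eq_zero hp' hfp, T.ord_eq_zero_of_notMem hgp fun h => hp' <| by
        rwa [hg, Ideal.span_singleton_le_iff_mem]]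
    · rw [T.ord_eq_zero hp hgp, T.ord_eq_zero_of_notMem hfp fun h => hp <| by
        rwa [hf, Ideal.span_singleton_le_iff_mem]]
    · rw [T.ord_eq_zero hp' hfp, T.ord_eq_zero hp hgp]

theorem mem_unitClasses (p : H1 R) (u : Additive (kappa p.1)ˣ) :
    u ∈ T.gerstenData.unitClasses p := by
  obtain ⟨a, b, ha, hb, h⟩ := exists_residUnit_div u.toMul
  have : u = T.gerstenData.res p a - T.gerstenData.res p b := h
  rw [this]
  exact sub_mem (T.gerstenData.res_mem_unitClasses ha) (T.gerstenData.res_mem_unitClasses hb)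

theorem symSpan_univ : T.gerstenData.symSpan Set.univ = ⊤ := by
  rw [eq_top_iff, ← MilnorK2.closure_symbol, AddSubgroup.closure_le]
  rintro _ ⟨f, g, rfl⟩
  obtain ⟨a, b, ha, hb, rfl⟩ := exists_fracUnit_div f
  obtain ⟨c, d, hc, hd, rfl⟩ := exists_fracUnit_div g
  have hmem : ∀ {a b : R}, a ≠ 0 → b ≠ 0 →
      MilnorK2.symbol (fracUnit a) (fracUnit b) ∈ T.gerstenData.symSpan Set.univ := fun ha hb =>
    T.gerstenData.sym_mem_symSpan trivial trivial ha hb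
  simp only [div_eq_mul_inv, MilnorK2.symbol_mul_left, MilnorK2.symbol_mul_right,
    MilnorK2.symbol_inv_left, MilnorK2.symbol_inv_right, SetLike.mem_coe]
  exact add_mem (add_mem (hmem ha hc) (neg_mem (hmem hb hc)))
    (add_mem (neg_mem (hmem ha hd)) (neg_mem (neg_mem (hmem hb hd))))

theorem symSpan_const_le :
    T.gerstenData.symSpan (Set.range (algebraMap k R)) ≤ constSymbols k (FractionRing R) := by
  refine T.gerstenData.symSpan_le ?_
  rintro _ ⟨a, rfl⟩ _ ⟨b, rfl⟩ - hb
  exact symbol_const_mem (R := R) _ (Units.mk0 b fun h => hb (by rw [h, map_zero]))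

theorem exists_tameBar_eq (hR : GerstenExact k R)
    {v : DirectSum (H1 R) (fun p => kappaUnitsModConst k p.1)} (hv : T.dv v = 0) :
    ∃ ξ, T.tameBar ξ = v := by
  have hlift : ∀ p : H1 R, ∀ x : kappaUnitsModConst k p.1, ∃ u : Additive (kappa p.1)ˣ,
      x = QuotientAddGroup.mk u ∧ (x = 0 → u = 0) := fun p x => by
    by_cases h : x = 0
    · exact ⟨0, h, fun _ => rfl⟩
    · obtain ⟨u, hu⟩ := QuotientAddGroup.mk_surjective x
      exact ⟨u, hu.symm, fun h' => absurd h' h⟩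
  choose u hu hu0 using fun p => hlift p (v p)
  classical
  have hfin : {p | u p ≠ 0}.Finite :=
    (DFinsupp.support v).finite_toSet.subset fun p hp =>
      DFinsupp.mem_support_iff.2 fun h => hp (hu0 p h)
  obtain ⟨ξ, -, hξ⟩ := (hR _ _ T.gerstenData).2 u (fun p => T.mem_unitClasses p _) hfin fun q =>
    (T.dv_apply_eq_ord hu q).symm.trans (by rw [hv]; rfl)
  refine ⟨ξ, DFinsupp.ext fun p => (T.tameBar_apply ξ p).trans ?_⟩
  exact (congrArg QuotientAddGroup.mk (hξ p)).trans (hu p).symm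

variable [UniqueFactorizationMonoid R]

theorem mem_cycleSubgroup (ξ : MilnorK2 (FractionRing R)) : ξ ∈ T.gerstenData.cycleSubgroup :=
  T.gerstenData.symSpan_univ_le_cycleSubgroup (T.symSpan_univ ▸ AddSubgroup.mem_top ξ)

theorem dv_tameBar (ξ : MilnorK2 (FractionRing R)) : T.dv (T.tameBar ξ) = 0 :=
  Finsupp.ext fun q =>
    (T.dv_apply_eq_ord (T.tameBar_apply ξ) q).trans ((T.mem_cycleSubgroup ξ).2.2 q)

theorem ker_tameBar (hR : GerstenExact k R) : T.tameBar.ker = constSymbols k (FractionRing R) := by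
  refine le_antisymm (fun ξ hξ => ?_) T.constSymbols_le_ker
  have hconst : ∀ p, ∃ c : kˣ,
      T.tameAt p ξ = T.gerstenData.res p (algebraMap k R c) := fun p => by
    have h := T.tameBar_apply ξ p
    rw [AddMonoidHom.mem_ker.1 hξ] at h
    obtain ⟨c, hc⟩ := (QuotientAddGroup.eq_zero_iff _).1 h.symm
    exact ⟨c, hc.symm.trans (congrArg Additive.ofMul (residUnit_algebraMap p c).symm)⟩
  choose c hc using hconst
  choose π _ hπ using fun p : H1 R => p.exists_prime
  have hcp : ∀ p p' : H1 R, algebraMap k R (c p) ∉ p'.1.asIdeal := fun p p' =>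
    p'.notMem_of_isUnit (isUnit_algebraMap_units _)
  have hfin := (T.mem_cycleSubgroup ξ).1
  let η := ∑ p ∈ hfin.toFinset, T.gerstenData.sym (π p) (algebraMap k R (c p))
  have hη : η ∈ constSymbols k (FractionRing R) :=
    sum_mem fun p _ => symbol_const_mem (R := R) _ _
  have htame : ∀ p, T.gerstenData.tame p (ξ - η) = 0 := fun p => by
    rw [map_sub, map_sum, sub_eq_zero, Finset.sum_eq_single p]
    · rw [T.gerstenData.tame_generator (hπ p) (hcp p p)]
      exact hc p
    · intro p' _ hne
      refine T.gerstenData.tame_of_notMem (fun h => hne (H1.eq_of_le ?_)) (hcp p' p)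
      rwa [hπ p', Ideal.span_singleton_le_iff_mem]
    · intro hp
      rw [T.gerstenData.tame_generator (hπ p) (hcp p p)]
      rw [Set.Finite.mem_toFinset, Set.mem_ofPred_eq, not_not] at hp
      exact (hc p).symm.trans hp
  have hmem : ξ - η ∈ T.gerstenData.symSpan Set.univ := by
    rw [T.symSpan_univ]
    exact AddSubgroup.mem_top _
  have := T.symSpan_const_le ((hR _ _ T.gerstenData).1 (ξ - η) hmem htame)
  rw [← sub_add_cancel ξ η]
  exact add_mem this hη

theorem exists_addEquiv_ker_dv (hR : GerstenExact k R) :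
    ∃ e : K2ModConst k (FractionRing R) ≃+ T.dv.ker,
      ∀ ξ : MilnorK2 (FractionRing R), (e (QuotientAddGroup.mk ξ)).1 = T.tameBar ξ := by
  let φ : MilnorK2 (FractionRing R) →+ T.dv.ker := T.tameBar.codRestrict _ T.dv_tameBar
  have hφ : Function.Surjective φ := fun v => by
    obtain ⟨ξ, hξ⟩ := T.exists_tameBar_eq hR v.2
    exact ⟨ξ, Subtype.ext hξ⟩
  have hker : constSymbols k (FractionRing R) = φ.ker := by
    rw [← T.ker_tameBar hR]
    ext ξ
    rw [AddMonoidHom.mem_ker, AddMonoidHom.mem_ker, Subtype.ext_iff]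
    rfl
  exact ⟨(QuotientAddGroup.quotientAddEquivOfEq hker).trans
    (QuotientAddGroup.quotientKerEquivOfSurjective φ hφ), fun ξ => rfl⟩

end Gersten

end TameComplex

end TameComplexes

open MvPolynomial in
/-- Let `k` be a field of characteristic 0, `F = k(x₁,…,xₙ)`, and `Z²(𝔸ⁿ)` the
free abelian group on the height-two primes of `k[x₁,…,xₙ]`.  The total tame symbol `Tame`
induces a group isomorphism from `K₂(F)/Const` onto the kernel of the divisor map
`div : ⊕_p κ(p)*/k* → Z²(𝔸ⁿ)` (direct sum over height-one primes `p` of `k[x₁,…,xₙ]`).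

Here `ν p` is the discrete valuation of the height-one prime `p` (pinned down by `hν_mul`,
`hν_char`), `tameAt p` is the tame symbol at `p` (pinned down on symbols by `htameAt`),
`TameBar` is the direct sum of the tame symbols followed by the projections
`κ(p)* → κ(p)*/k*` (pinned down componentwise by `hTameBar`), and `dv` is the divisor map
(pinned down by `hdv`, via the order functions `ord_q` of the one-dimensional local rings
`(A_p)_q`, `A_p = k[x₁,…,xₙ]/p`, with each height-one prime `q` of `A_p` identified with the
corresponding height-two prime of `k[x₁,…,xₙ]`). -/
theorem tame_induces_iso_onto_ker_div
    (k : Type) [Field k] [CharZero k] (n : ℕ)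
    [DecidableEq (H1 (MvPolynomial (Fin n) k))]
    (ν : H1 (MvPolynomial (Fin n) k) → (FractionRing (MvPolynomial (Fin n) k))ˣ → ℤ)
    (hν_mul : ∀ p f g, ν p (f * g) = ν p f + ν p g)
    (hν_char : ∀ (p : H1 (MvPolynomial (Fin n) k)) (a : MvPolynomial (Fin n) k)
      (u : (FractionRing (MvPolynomial (Fin n) k))ˣ),
      (u : FractionRing (MvPolynomial (Fin n) k)) = algebraMap _ _ a →
      ∀ m : ℕ, (ν p u = m ↔ a ∈ symbPow p.1 m ∧ a ∉ symbPow p.1 (m + 1)))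
    (tameAt : ∀ p : H1 (MvPolynomial (Fin n) k),
      MilnorK2 (FractionRing (MvPolynomial (Fin n) k)) →+ Additive (kappa p.1)ˣ)
    (htameAt : ∀ (p : H1 (MvPolynomial (Fin n) k))
      (f g : (FractionRing (MvPolynomial (Fin n) k))ˣ) (a s : MvPolynomial (Fin n) k),
      a ∉ p.1.asIdeal → s ∉ p.1.asIdeal →
      ((-1 : FractionRing (MvPolynomial (Fin n) k)) ^ (ν p f * ν p g)
          * (g : FractionRing (MvPolynomial (Fin n) k)) ^ (ν p f)
          * (f : FractionRing (MvPolynomial (Fin n) k)) ^ (-(ν p g))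
        = algebraMap _ _ a / algebraMap _ _ s) →
      ∀ u : (kappa p.1)ˣ, (u : kappa p.1) * resid p.1 s = resid p.1 a →
        tameAt p (MilnorK2.symbol f g) = Additive.ofMul u)
    (TameBar : MilnorK2 (FractionRing (MvPolynomial (Fin n) k)) →+
      DirectSum (H1 (MvPolynomial (Fin n) k)) (fun p => kappaUnitsModConst k p.1))
    (hTameBar : ∀ ξ p, TameBar ξ p = QuotientAddGroup.mk (tameAt p ξ))
    (dv : DirectSum (H1 (MvPolynomial (Fin n) k)) (fun p => kappaUnitsModConst k p.1)
      →+ (H2 (MvPolynomial (Fin n) k) →₀ ℤ))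
    (hdv : ∀ (p : H1 (MvPolynomial (Fin n) k)) (a b : MvPolynomial (Fin n) k),
      a ∉ p.1.asIdeal → b ∉ p.1.asIdeal →
      ∀ u : (kappa p.1)ˣ, (u : kappa p.1) * resid p.1 b = resid p.1 a →
      ∀ q : H2 (MvPolynomial (Fin n) k),
        (¬ p.1.asIdeal ≤ q.1.asIdeal →
          dv (DirectSum.of _ p (QuotientAddGroup.mk (Additive.ofMul u))) q = 0) ∧
        (p.1.asIdeal ≤ q.1.asIdeal →
          ∀ hQ : (Ideal.map (Ideal.Quotient.mk p.1.asIdeal) q.1.asIdeal).IsPrime,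
          ∀ ma mb : ℕ,
            lengthQuot _ hQ (Ideal.Quotient.mk p.1.asIdeal a) = (ma : ℕ∞) →
            lengthQuot _ hQ (Ideal.Quotient.mk p.1.asIdeal b) = (mb : ℕ∞) →
            dv (DirectSum.of _ p (QuotientAddGroup.mk (Additive.ofMul u))) q
              = (ma : ℤ) - (mb : ℤ))) :
    ∃ e : K2ModConst k (FractionRing (MvPolynomial (Fin n) k)) ≃+ AddMonoidHom.ker dv,
      ∀ ξ : MilnorK2 (FractionRing (MvPolynomial (Fin n) k)),
        ((e (QuotientAddGroup.mk ξ)).1 : DirectSum (H1 (MvPolynomial (Fin n) k))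
          (fun p => kappaUnitsModConst k p.1)) = TameBar ξ := by
  exact TameComplex.exists_addEquiv_ker_dv
    { ν := ν, ν_mul := hν_mul, ν_char := hν_char, tameAt := tameAt, tameAt_symbol := htameAt,
      tameBar := TameBar, tameBar_apply := hTameBar, dv := dv, dv_of := hdv }
    (GerstenExact.mvPolynomial k n)
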